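/- arXiv:0811.3833 — 5 statements merged into one kernel-verified Lean document; each statement's English description precedes it below -/
import Mathlib

section
/- Let K be a field, L a nonzero positive sublattice of ℤ^m, and (L,ρ) a partial character on ℤ^m. Then the lattice ideal I_{L,ρ} is a complete intersection if and only if for every face F of σ_L = pos_ℚ(A) the lattice ideal I_{L∩ℤ^{𝔼_F},ρ} is a complete intersection. -/
open MvPolynomial

namespace LatticePaper

variable {m n : ℕ}

/-- The positive part `u₊` of an integer vector, as an exponent vector. -/
noncomputable def pp (u : Fin m → ℤ) : Fin m →₀ ℕ :=
  Finsupp.equivFunOnFinite.symm fun i => (u i).toNat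

/-- The negative part `u₋` of an integer vector, as an exponent vector. -/
noncomputable def np (u : Fin m → ℤ) : Fin m →₀ ℕ :=
  Finsupp.equivFunOnFinite.symm fun i => (-u i).toNat

/-- The positive part `u₊` as an integer vector. -/
def ppz (u : Fin m → ℤ) : Fin m → ℤ := fun i => max (u i) 0

/-- The negative part `u₋` as an integer vector. -/
def npz (u : Fin m → ℤ) : Fin m → ℤ := fun i => max (-u i) 0

/-- `ℤ^E`, the subgroup of vectors supported on `E`. -/
def ZE (E : Set (Fin m)) : AddSubgroup (Fin m → ℤ) where
  carrier := {u | ∀ i, i ∉ E → u i = 0}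
  add_mem' := by intro a b ha hb i hi; simp [ha i hi, hb i hi]
  zero_mem' := by intro i _; rfl
  neg_mem' := by intro a ha i hi; simp [ha i hi]

/-- `L` is a positive lattice: `L ∩ ℕ^m = {0}`. -/
def IsPositive (L : AddSubgroup (Fin m → ℤ)) : Prop :=
  ∀ u ∈ L, (∀ i, 0 ≤ u i) → u = 0

/-- The binomial `B(u) = x^{u₊} - ρ(u) x^{u₋}` attached to a partial character `ρ` on `L`. -/
noncomputable def Bpoly (K : Type*) [Field K] {L : AddSubgroup (Fin m → ℤ)}
    (ρ : AddChar L Kˣ) (u : L) : MvPolynomial (Fin m) K :=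
  monomial (pp (u : Fin m → ℤ)) (1 : K) - monomial (np (u : Fin m → ℤ)) ((ρ u : Kˣ) : K)

/-- The ideal generated by the binomials `B(u)` for `u ∈ L` with `u ∈ S`. -/
noncomputable def latIdealOn (K : Type*) [Field K] {L : AddSubgroup (Fin m → ℤ)}
    (ρ : AddChar L Kˣ) (S : Set (Fin m → ℤ)) : Ideal (MvPolynomial (Fin m) K) :=
  Ideal.span {f | ∃ u : L, (u : Fin m → ℤ) ∈ S ∧ f = Bpoly K ρ u}

/-- The lattice ideal `I_{L,ρ}`. -/
noncomputable def latIdeal (K : Type*) [Field K] {L : AddSubgroup (Fin m → ℤ)}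
    (ρ : AddChar L Kˣ) : Ideal (MvPolynomial (Fin m) K) :=
  latIdealOn K ρ Set.univ

/-- The configuration vectors, regarded over `ℚ`. -/
def ratA (A : Fin m → Fin n → ℤ) : Fin m → Fin n → ℚ := fun i j => (A i j : ℚ)

/-- The rational polyhedral cone `pos_ℚ(A)`. -/
def cone (A : Fin m → Fin n → ℤ) : Set (Fin n → ℚ) :=
  {x | ∃ lam : Fin m → ℚ, (∀ i, 0 ≤ lam i) ∧ x = ∑ i, lam i • ratA A i}

/-- `F` is a face of the cone `pos_ℚ(A)`. -/
def IsFace (A : Fin m → Fin n → ℤ) (F : Set (Fin n → ℚ)) : Prop :=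
  ∃ c : Fin n → ℚ, (∀ x ∈ cone A, 0 ≤ ∑ j, c j * x j) ∧
    F = cone A ∩ {x | ∑ j, c j * x j = 0}

/-- `𝔼_F = {i | a_i ∈ F}`. -/
def EF (A : Fin m → Fin n → ℤ) (F : Set (Fin n → ℚ)) : Set (Fin m) :=
  {i | ratA A i ∈ F}

/-- `A` is the configuration of vectors associated to the lattice `L`:
the `A`-degree map `ℤ^m → ℤ^n` is surjective with kernel `Sat(L)`. -/
def IsConfig (L : AddSubgroup (Fin m → ℤ)) (A : Fin m → Fin n → ℤ) : Prop :=
  (∀ u : Fin m → ℤ, (∑ i, u i • A i) = 0 ↔ ∃ d : ℤ, d ≠ 0 ∧ d • u ∈ L) ∧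
  Function.Surjective fun u : Fin m → ℤ => ∑ i, u i • A i

/-- A polynomial is `A`-homogeneous if all its monomials have the same `A`-degree. -/
def AHomog {K : Type*} [Field K] (A : Fin m → Fin n → ℤ) (f : MvPolynomial (Fin m) K) : Prop :=
  ∀ d ∈ f.support, ∀ e ∈ f.support, (∑ i, (d i : ℤ) • A i) = ∑ i, (e i : ℤ) • A i

/-- The family of binomials `B(u i)` is a cover of `A`. -/
def IsCover {q : ℕ} (A : Fin m → Fin n → ℤ) (u : Fin q → Fin m → ℤ) : Prop :=
  ∀ E : Set (Fin m), (∀ F : Set (Fin n → ℚ), IsFace A F → E ≠ EF A F) →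
    ∃ i, (ppz (u i) ∈ ZE E ∧ npz (u i) ∉ ZE E) ∨ (npz (u i) ∈ ZE E ∧ ppz (u i) ∉ ZE E)

/-- The minimal number of generators of an ideal. -/
noncomputable def mu {R : Type*} [CommRing R] (I : Ideal R) : ℕ :=
  sInf {s : ℕ | ∃ f : Fin s → R, Ideal.span (Set.range f) = I}

/-- The arithmetical rank of an ideal. -/
noncomputable def ara {R : Type*} [CommRing R] (I : Ideal R) : ℕ :=
  sInf {s : ℕ | ∃ f : Fin s → R, (∀ i, f i ∈ I) ∧
    Ideal.radical (Ideal.span (Set.range f)) = Ideal.radical I}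

/-- A binomial: a sum of (at most) two monomials. -/
def IsBinomial {K : Type*} [Field K] (f : MvPolynomial (Fin m) K) : Prop :=
  ∃ (a b : Fin m →₀ ℕ) (c d : K), f = monomial a c + monomial b d

/-- The binomial arithmetical rank of an ideal of a polynomial ring. -/
noncomputable def bar {K : Type*} [Field K] (I : Ideal (MvPolynomial (Fin m) K)) : ℕ :=
  sInf {s : ℕ | ∃ f : Fin s → MvPolynomial (Fin m) K,
    (∀ i, f i ∈ I ∧ IsBinomial (f i)) ∧
    Ideal.radical (Ideal.span (Set.range f)) = Ideal.radical I}

/-- The rank of a sublattice of `ℤ^m`. -/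
noncomputable def latRank (L : AddSubgroup (Fin m → ℤ)) : ℕ :=
  Module.finrank ℤ ↥(AddSubgroup.toIntSubmodule L)

/-- The toric ideal of a configuration `A` (trivial character). -/
noncomputable def toricIdeal (K : Type*) [Field K] (A : Fin m → Fin n → ℤ) :
    Ideal (MvPolynomial (Fin m) K) :=
  Ideal.span {f | ∃ u : Fin m → ℤ, (∑ i, u i • A i) = 0 ∧
    f = monomial (pp u) (1 : K) - monomial (np u) 1}

/-- The lattice ideal of `L` with trivial character. -/
noncomputable def latIdeal1 (K : Type*) [Field K] (L : AddSubgroup (Fin m → ℤ)) :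
    Ideal (MvPolynomial (Fin m) K) :=
  Ideal.span {f | ∃ u ∈ L, f = monomial (pp u) (1 : K) - monomial (np u) 1}

/-- A full configuration of vectors: `pos_ℚ(A)` is an `n`-dimensional simplex cone generated
by the first `n` vectors, and the remaining vectors lie in its relative interior. -/
def IsFull (hnm : n ≤ m) (A : Fin m → Fin n → ℤ) : Prop :=
  LinearIndependent ℚ (fun i : Fin n => ratA A (Fin.castLE hnm i)) ∧
  cone A = cone (fun i : Fin n => A (Fin.castLE hnm i)) ∧
  ∀ i : Fin m, n ≤ (i : ℕ) → ∃ lam : Fin n → ℚ, (∀ k, 0 < lam k) ∧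
    ratA A i = ∑ k, lam k • ratA A (Fin.castLE hnm k)

end LatticePaper

namespace LatticePaper

/-- The (3,3)-Veronese configuration. -/
def veroneseA : Fin 10 → Fin 3 → ℤ :=
  ![![3,0,0], ![0,3,0], ![0,0,3], ![2,1,0], ![1,2,0],
    ![0,2,1], ![0,1,2], ![2,0,1], ![1,0,2], ![1,1,1]]

def e1v (m q : ℕ) : Fin 4 → ℤ :=
  ![(m : ℤ) + 2 * (q : ℤ) - 3, -(m : ℤ) + 2 * (q : ℤ) + 5, -1, -1]

def e2v (m q : ℕ) : Fin 4 → ℤ :=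
  ![-(m : ℤ) - 2 * (q : ℤ) + 5, (m : ℤ) - 2 * (q : ℤ) - 3, -1, -1]

def e3v (m q : ℕ) : Fin 4 → ℤ :=
  ![-(m : ℤ) - 2 * (q : ℤ) + 5, -1, (m : ℤ) - 3, -1]

/-- The lattice `L(m)` of the examples. -/
def Lm (m q : ℕ) : AddSubgroup (Fin 4 → ℤ) :=
  AddSubgroup.closure {e1v m q, e2v m q, e3v m q}

noncomputable def fpoly1 (K : Type*) [Field K] (m q : ℕ) : MvPolynomial (Fin 4) K :=
  X 0 ^ (m + 2 * q - 3) - X 1 ^ (m - 2 * q - 5) * X 2 * X 3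

noncomputable def fpoly2 (K : Type*) [Field K] (m q : ℕ) : MvPolynomial (Fin 4) K :=
  X 1 ^ (m - 2 * q - 3) - X 0 ^ (m + 2 * q - 5) * X 2 * X 3

noncomputable def fpoly3 (K : Type*) [Field K] (m q : ℕ) : MvPolynomial (Fin 4) K :=
  X 2 ^ (m - 3) - X 0 ^ (m + 2 * q - 5) * X 1 * X 3

noncomputable def fpoly123 (K : Type*) [Field K] (m : ℕ) : MvPolynomial (Fin 4) K :=
  if Even m then X 3 ^ (m - 3) - X 0 * X 1 ^ (m - 5) * X 2
  else X 3 ^ (m - 3) - X 0 ^ (m - 3) * X 1 * X 2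

end LatticePaper

namespace LatticePaper

/-- exponent vector as an integer vector -/
def zv (d : Fin m →₀ ℕ) : Fin m → ℤ := fun i => (d i : ℤ)

theorem zv_add (d e : Fin m →₀ ℕ) : zv (d + e) = zv d + zv e := by
  funext i; simp [zv]

theorem zv_pp_sub (u : Fin m → ℤ) : zv (pp u) - zv (np u) = u := by
  funext i; simp [zv, pp, np]

/-- weights in the quotient group -/
def wt (L : AddSubgroup (Fin m → ℤ)) (i : Fin m) : (Fin m → ℤ) ⧸ L :=
  QuotientAddGroup.mk (Pi.single i 1)

theorem weight_wt (L : AddSubgroup (Fin m → ℤ)) (d : Fin m →₀ ℕ) :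
    Finsupp.weight (wt L) d = QuotientAddGroup.mk (zv d) := by
  rw [Finsupp.weight_apply, Finsupp.sum_fintype _ _ (by simp)]
  have : zv d = ∑ i, d i • (Pi.single i 1 : Fin m → ℤ) := by
    funext j; simp [zv, Finset.sum_apply, Pi.single_apply]
  rw [this, ← QuotientAddGroup.mk'_apply, map_sum]
  simp [wt]

theorem Bpoly_homog {K : Type*} [Field K] {L : AddSubgroup (Fin m → ℤ)}
    (ρ : AddChar L Kˣ) (u : L) :
    IsWeightedHomogeneous (wt L) (Bpoly K ρ u)
      (QuotientAddGroup.mk (zv (pp (u : Fin m → ℤ)))) := by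
  unfold Bpoly
  apply IsWeightedHomogeneous.sub
  · exact isWeightedHomogeneous_monomial _ _ _ (weight_wt _ _)
  · refine isWeightedHomogeneous_monomial _ _ _ ?_
    rw [weight_wt, QuotientAddGroup.eq, neg_add_eq_sub, zv_pp_sub]
    exact u.2

theorem comp_mul {K : Type*} [Field K] {G : Type*} [AddCommGroup G] (w : Fin m → G)
    (s : MvPolynomial (Fin m) K) (d b : G) (hs : IsWeightedHomogeneous w s d)
    (r : MvPolynomial (Fin m) K) :
    weightedHomogeneousComponent w b (r * s) = weightedHomogeneousComponent w (b - d) r * s := by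
  classical
  induction r using MvPolynomial.induction_on' with
  | monomial e c =>
    have h1 : IsWeightedHomogeneous w (monomial e c) (Finsupp.weight w e) :=
      isWeightedHomogeneous_monomial _ _ _ rfl
    by_cases h : Finsupp.weight w e + d = b
    · subst h
      rw [(h1.mul hs).weightedHomogeneousComponent_same, add_sub_cancel_right,
        h1.weightedHomogeneousComponent_same]
    · rw [(h1.mul hs).weightedHomogeneousComponent_ne _ (Ne.symm h),
        h1.weightedHomogeneousComponent_ne _ (by intro h'; exact h (by rw [← h']; abel)), zero_mul]
  | add p q hp hq => simp only [add_mul, map_add, hp, hq]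

theorem comp_mem {K : Type*} [Field K] {G : Type*} [AddCommGroup G] (w : Fin m → G)
    (S : Set (MvPolynomial (Fin m) K)) (hS : ∀ s ∈ S, ∃ d, IsWeightedHomogeneous w s d)
    (b : G) (f : MvPolynomial (Fin m) K) (hf : f ∈ Ideal.span S) :
    weightedHomogeneousComponent w b f ∈ Ideal.span S := by
  have : ∀ r, weightedHomogeneousComponent w b (r * f) ∈ Ideal.span S := by
    induction hf using Submodule.span_induction with
    | mem x hx =>
      intro r
      obtain ⟨d, hd⟩ := hS x hx
      rw [comp_mul w x d b hd r]
      exact Ideal.mul_mem_left _ _ (Ideal.subset_span hx)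
    | zero => simp
    | add x y _ _ hx hy => intro r; rw [mul_add, map_add]; exact Ideal.add_mem _ (hx r) (hy r)
    | smul a x _ hx => intro r; rw [smul_eq_mul, ← mul_assoc]; exact hx _
  simpa using this 1

theorem fiber_bound (L : AddSubgroup (Fin m → ℤ)) (hpos : IsPositive L) (b : (Fin m → ℤ) ⧸ L) :
    ∃ k, ∀ d : Fin m →₀ ℕ, Finsupp.weight (wt L) d = b → d.degree < k := by
  have hfin : {d : Fin m →₀ ℕ | Finsupp.weight (wt L) d = b}.Finite := by
    refine IsAntichain.finite_of_partiallyWellOrderedOn (r := (· ≤ ·)) ?_ (Set.isPWO_of_wellQuasiOrderedLE _)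
    intro d hd e he hne hle
    apply hne
    have hd' : Finsupp.weight (wt L) d = b := hd
    have he' : Finsupp.weight (wt L) e = b := he
    rw [← he', weight_wt, weight_wt, QuotientAddGroup.eq, neg_add_eq_sub] at hd'
    have := hpos _ hd' (fun i => by
      have := hle i
      simp [zv]; exact this)
    ext i
    have h := congrFun this i
    simp [zv] at h
    omega
  obtain ⟨k, hk⟩ := (hfin.image Finsupp.degree).bddAbove
  exact ⟨k + 1, fun d hd => Nat.lt_succ_of_le (hk ⟨d, hd, rfl⟩)⟩

theorem nakayama {K : Type*} [Field K] (L : AddSubgroup (Fin m → ℤ)) (hpos : IsPositive L)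
    (S T : Set (MvPolynomial (Fin m) K))
    (hS : ∀ s ∈ S, ∃ d, IsWeightedHomogeneous (wt L) s d)
    (hT : ∀ s ∈ T, ∃ d, IsWeightedHomogeneous (wt L) s d)
    (h : Ideal.span S ≤ Ideal.span T ⊔
      Ideal.span (Set.range (X : Fin m → MvPolynomial (Fin m) K)) * Ideal.span S) :
    Ideal.span S ≤ Ideal.span T := by
  classical
  have key : ∀ k : ℕ, ∀ b, (∀ d : Fin m →₀ ℕ, Finsupp.weight (wt L) d = b → d.degree < k) →
      ∀ f ∈ Ideal.span S, weightedHomogeneousComponent (wt L) b f ∈ Ideal.span T := by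
    intro k
    induction k with
    | zero =>
      intro b hb f _
      have : weightedHomogeneousComponent (wt L) b f = 0 :=
        weightedHomogeneousComponent_eq_zero' _ _ fun d _ hd => absurd (hb d hd) (by simp)
      rw [this]; exact zero_mem _
    | succ k ih =>
      intro b hb f hf
      obtain ⟨j, hj, g, hg, rfl⟩ := Submodule.mem_sup.1 (h hf)
      rw [map_add]
      refine Ideal.add_mem _ (comp_mem _ T hT b j hj) ?_
      refine Submodule.mul_induction_on hg ?_ ?_
      · intro r hr
        induction hr using Submodule.span_induction with
        | mem x hx =>
          obtain ⟨i, rfl⟩ := hx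
          intro g hg
          rw [mul_comm, comp_mul (wt L) _ _ b (isWeightedHomogeneous_X K (wt L) i)]
          refine Ideal.mul_mem_right _ _ (ih _ ?_ g hg)
          intro d hd
          have := hb (d + Finsupp.single i 1) (by
            rw [map_add, hd, Finsupp.weight_single]; simp)
          rw [map_add, Finsupp.degree_single] at this
          omega
        | zero => simp
        | add x y _ _ hx hy =>
          intro g hg; rw [add_mul, map_add]; exact Ideal.add_mem _ (hx g hg) (hy g hg)
        | smul a x _ hx =>
          intro g hg
          rw [smul_eq_mul, mul_comm a x, mul_assoc]
          exact hx _ (Ideal.mul_mem_left _ _ hg)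
      · intro x y hx hy
        rw [map_add]; exact Ideal.add_mem _ hx hy
  rw [Ideal.span_le]
  intro s hs
  obtain ⟨d, hd⟩ := hS s hs
  obtain ⟨k, hk⟩ := fiber_bound L hpos d
  have := key k d hk s (Ideal.subset_span hs)
  rwa [hd.weightedHomogeneousComponent_same] at this

/-- modulo `𝔪 I`, the ideal is spanned over `K` by generators -/
theorem map_mkQ_span {K : Type*} [Field K] (S : Set (MvPolynomial (Fin m) K))
    (N : Submodule K (MvPolynomial (Fin m) K))
    (hN : ∀ f, f ∈ N ↔ f ∈ Ideal.span (Set.range (X : Fin m → MvPolynomial (Fin m) K)) *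
      Ideal.span S) (f : MvPolynomial (Fin m) K) (hf : f ∈ Ideal.span S) :
    f ∈ Submodule.span K S ⊔ N := by
  have : ∀ r, r * f ∈ Submodule.span K S ⊔ N := by
    induction hf using Submodule.span_induction with
    | mem x hx =>
      intro r
      have h1 : r = (r - C (constantCoeff r)) + C (constantCoeff r) := by ring
      rw [h1, add_mul]
      refine Submodule.add_mem _ (Submodule.mem_sup_right ?_) (Submodule.mem_sup_left ?_)
      · rw [hN]
        refine Ideal.mul_mem_mul ?_ (Ideal.subset_span hx)
        have : Set.range (X : Fin m → MvPolynomial (Fin m) K) = X '' Set.univ := by simp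
        rw [this, mem_ideal_span_X_image]
        intro d hd
        have hd0 : d ≠ 0 := by
          rintro rfl
          simp [mem_support_iff, constantCoeff_eq] at hd
        obtain ⟨i, hi⟩ := Finsupp.ne_iff.1 hd0
        exact ⟨i, Set.mem_univ _, hi⟩
      · rw [← smul_eq_C_mul]
        exact Submodule.smul_mem _ _ (Submodule.subset_span hx)
    | zero => simp
    | add x y _ _ hx hy => intro r; rw [mul_add]; exact Submodule.add_mem _ (hx r) (hy r)
    | smul a x _ hx => intro r; rw [smul_eq_mul, ← mul_assoc]; exact hx _
  simpa using this 1

theorem exists_binomial_gens {K : Type*} [Field K] {L : AddSubgroup (Fin m → ℤ)}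
    (hpos : IsPositive L) (ρ : AddChar L Kˣ) (H : Set (Fin m → ℤ)) (s : ℕ)
    (f : Fin s → MvPolynomial (Fin m) K) (hf : Ideal.span (Set.range f) = latIdealOn K ρ H) :
    ∃ t ≤ s, ∃ u : Fin t → L, (∀ i, (u i : Fin m → ℤ) ∈ H) ∧
      Ideal.span (Set.range fun i => Bpoly K ρ (u i)) = latIdealOn K ρ H := by
  classical
  set S : Set (MvPolynomial (Fin m) K) := {f | ∃ u : L, (u : Fin m → ℤ) ∈ H ∧ f = Bpoly K ρ u}
    with hSdef
  have hI : latIdealOn K ρ H = Ideal.span S := rfl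
  set N : Submodule K (MvPolynomial (Fin m) K) := Submodule.restrictScalars K
    (Ideal.span (Set.range (X : Fin m → MvPolynomial (Fin m) K)) * Ideal.span S) with hN
  have hNmem : ∀ f, f ∈ N ↔ f ∈ Ideal.span (Set.range (X : Fin m → MvPolynomial (Fin m) K)) *
      Ideal.span S := fun f => Iff.rfl
  obtain ⟨b, hbS, hbspan, hbli⟩ := exists_linearIndependent K (N.mkQ '' S)
  have hle : Set.range ((↑) : b → (MvPolynomial (Fin m) K ⧸ N)) ≤ Submodule.span K (Set.range (N.mkQ ∘ f)) := by
    rintro _ ⟨⟨y, hy⟩, rfl⟩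
    obtain ⟨x, hx, rfl⟩ := hbS hy
    have h1 : x ∈ Ideal.span (Set.range f) := by
      rw [hf, hI]; exact Ideal.subset_span hx
    have h2 := map_mkQ_span (Set.range f) N (by rw [hf, hI]; exact hNmem) x h1
    have h3 := Submodule.mem_map_of_mem (f := N.mkQ) h2
    rw [Submodule.map_sup, Submodule.map_span, ← Set.range_comp, Submodule.mkQ_map_self,
      sup_bot_eq] at h3
    exact h3
  have hbli' : LinearIndependent K ((↑) : b → (MvPolynomial (Fin m) K ⧸ N)) := hbli
  haveI : Finite b := hbli'.finite_of_le_span_finite _ (Set.range (N.mkQ ∘ f)) hle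
  haveI : Fintype b := Fintype.ofFinite b
  have hcard : Fintype.card b ≤ s := by
    have := linearIndependent_le_span_aux' _ hbli' (Set.range (N.mkQ ∘ f)) hle
    refine this.trans ?_
    simpa using Fintype.card_range_le (N.mkQ ∘ f)
  have hch : ∀ y : b, ∃ u : L, (u : Fin m → ℤ) ∈ H ∧ N.mkQ (Bpoly K ρ u) = y := by
    rintro ⟨y, hy⟩
    obtain ⟨x, ⟨u, hu, rfl⟩, h⟩ := hbS hy
    exact ⟨u, hu, h⟩
  choose v hv1 hv2 using hch
  let e := (Fintype.equivFin b).symm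
  refine ⟨Fintype.card b, hcard, fun i => v (e i), fun i => hv1 _, ?_⟩
  have hsub : (Set.range fun i => Bpoly K ρ (v (e i))) ⊆ S := by
    rintro _ ⟨i, rfl⟩; exact ⟨_, hv1 _, rfl⟩
  have hhom : ∀ s ∈ S, ∃ d, IsWeightedHomogeneous (wt L) s d := by
    rintro _ ⟨u, _, rfl⟩; exact ⟨_, Bpoly_homog ρ u⟩
  rw [hI]
  refine le_antisymm (Ideal.span_mono hsub) ?_
  refine nakayama L hpos S _ hhom (fun s hs => hhom s (hsub hs)) ?_
  rw [Ideal.span_le]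
  intro x hx
  have h1 : N.mkQ x ∈ Submodule.span K (N.mkQ '' S) :=
    Submodule.subset_span (Set.mem_image_of_mem _ hx)
  rw [← hbspan] at h1
  have hb : b = N.mkQ '' (Set.range fun i => Bpoly K ρ (v (e i))) := by
    ext y; constructor
    · intro hy
      refine ⟨_, ⟨e.symm ⟨y, hy⟩, rfl⟩, ?_⟩
      simp only [Equiv.apply_symm_apply]
      exact hv2 _
    · rintro ⟨_, ⟨i, rfl⟩, rfl⟩
      simp only
      rw [hv2]
      exact (e i).2
  rw [hb, ← Submodule.map_span] at h1
  obtain ⟨y, hy, hyx⟩ := h1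
  have h2 : x - y ∈ N := by
    rw [← Submodule.Quotient.mk_eq_zero, Submodule.Quotient.mk_sub, sub_eq_zero]
    exact hyx.symm
  have : x = y + (x - y) := by ring
  rw [this]
  refine Submodule.add_mem _ (Submodule.mem_sup_left ?_) (Submodule.mem_sup_right h2)
  exact Submodule.span_le_restrictScalars K (MvPolynomial (Fin m) K) _ hy

theorem gens_generate {K : Type*} [Field K] {L : AddSubgroup (Fin m → ℤ)}
    (ρ : AddChar L Kˣ) (H : AddSubgroup (Fin m → ℤ)) {t : ℕ} (u : Fin t → L)
    (hu : ∀ i, (u i : Fin m → ℤ) ∈ H)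
    (h : Ideal.span (Set.range fun i => Bpoly K ρ (u i)) = latIdealOn K ρ (H : Set (Fin m → ℤ))) :
    AddSubgroup.closure (Set.range fun i => (u i : Fin m → ℤ)) = L ⊓ H := by
  classical
  set L' := AddSubgroup.closure (Set.range fun i => (u i : Fin m → ℤ)) with hL'
  have hle : L' ≤ L ⊓ H := by
    rw [hL', AddSubgroup.closure_le]
    rintro _ ⟨i, rfl⟩
    exact ⟨(u i).2, hu i⟩
  refine le_antisymm hle ?_
  rintro v ⟨hvL, hvH⟩
  by_contra hv
  have hLL : L' ≤ L := hle.trans inf_le_left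
  let c : (Fin m →₀ ℕ) → K := fun w =>
    if hw : zv w - zv (pp v) ∈ L' then ((ρ ⟨_, hLL hw⟩ : Kˣ) : K) else 0
  let φ : MvPolynomial (Fin m) K →ₗ[K] K := (basisMonomials (Fin m) K).constr K c
  have hφ : ∀ w a, φ (monomial w a) = a * c w := by
    intro w a
    have : (monomial w a : MvPolynomial (Fin m) K) = a • basisMonomials (Fin m) K w := by
      simp [smul_monomial]
    rw [this, map_smul, Module.Basis.constr_basis, smul_eq_mul]
  have hzero : ∀ g ∈ Ideal.span (Set.range fun i => Bpoly K ρ (u i)), φ g = 0 := by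
    intro g hg
    have : ∀ r, φ (r * g) = 0 := by
      induction hg using Submodule.span_induction with
      | mem x hx =>
        obtain ⟨i, rfl⟩ := hx
        intro r
        induction r using MvPolynomial.induction_on' with
        | monomial e a =>
          simp only [Bpoly, mul_sub, monomial_mul, map_sub, hφ]
          have hui : (u i : Fin m → ℤ) ∈ L' := AddSubgroup.subset_closure ⟨i, rfl⟩
          have heq : zv (e + pp (u i : Fin m → ℤ)) - zv (pp v) =
              (u i : Fin m → ℤ) + (zv (e + np (u i : Fin m → ℤ)) - zv (pp v)) := by
            have h3 := zv_pp_sub (u i : Fin m → ℤ)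
            rw [sub_eq_iff_eq_add] at h3
            rw [zv_add, zv_add, h3]
            abel
          by_cases hw : zv (e + np (u i : Fin m → ℤ)) - zv (pp v) ∈ L'
          · have hw' : zv (e + pp (u i : Fin m → ℤ)) - zv (pp v) ∈ L' := by
              rw [heq]; exact add_mem hui hw
            have : (⟨_, hLL hw'⟩ : L) = u i + ⟨_, hLL hw⟩ := Subtype.ext heq
            simp only [c, dif_pos hw, dif_pos hw']
            rw [this, AddChar.map_add_eq_mul, Units.val_mul]
            ring
          · have hw' : zv (e + pp (u i : Fin m → ℤ)) - zv (pp v) ∉ L' := by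
              rw [heq]; intro h'; exact hw ((AddSubgroup.add_mem_cancel_left _ hui).1 h')
            simp only [c, dif_neg hw, dif_neg hw']
            ring
        | add p q hp hq => rw [add_mul, map_add, hp, hq, add_zero]
      | zero => simp
      | add x y _ _ hx hy => intro r; rw [mul_add, map_add, hx, hy, add_zero]
      | smul a x _ hx => intro r; rw [smul_eq_mul, ← mul_assoc]; exact hx _
    simpa using this 1
  have hB : Bpoly K ρ ⟨v, hvL⟩ ∈ Ideal.span (Set.range fun i => Bpoly K ρ (u i)) := by
    rw [h]; exact Ideal.subset_span ⟨_, hvH, rfl⟩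
  have := hzero _ hB
  simp only [Bpoly, map_sub, hφ] at this
  have h1 : c (pp v) = 1 := by
    have h0 : zv (pp v) - zv (pp v) ∈ L' := by rw [sub_self]; exact zero_mem _
    have h0' : (⟨_, hLL h0⟩ : L) = 0 := Subtype.ext (sub_self _)
    simp only [c, dif_pos h0]
    rw [h0', AddChar.map_zero_eq_one, Units.val_one]
  have h2 : c (np v) = 0 := by
    have h0 : zv (np v) - zv (pp v) ∉ L' := by
      rw [← neg_sub, zv_pp_sub]
      intro h'; exact hv (by simpa using neg_mem h')
    simp only [c, dif_neg h0]
  rw [h1, h2] at this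
  simp at this

theorem latRank_eq {t : ℕ} (M : AddSubgroup (Fin m → ℤ)) (u : Fin t → Fin m → ℤ)
    (h : AddSubgroup.closure (Set.range u) = M) :
    latRank M = (Set.range u).finrank ℤ := by
  subst h
  unfold latRank Set.finrank
  have : AddSubgroup.toIntSubmodule (AddSubgroup.closure (Set.range u)) =
      Submodule.span ℤ (Set.range u) := by
    apply_fun Submodule.toAddSubgroup using Submodule.toAddSubgroup_injective
    rw [Submodule.span_int_eq_addSubgroupClosure]
    rfl
  rw [this]

theorem mu_nonempty {K : Type*} [Field K] (I : Ideal (MvPolynomial (Fin m) K)) :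
    {s : ℕ | ∃ f : Fin s → MvPolynomial (Fin m) K, Ideal.span (Set.range f) = I}.Nonempty := by
  obtain ⟨s, f, hf⟩ := Submodule.fg_iff_exists_fin_generating_family.1
    (IsNoetherian.noetherian I)
  exact ⟨s, f, hf⟩

theorem exists_mu_gens {K : Type*} [Field K] {L : AddSubgroup (Fin m → ℤ)}
    (hpos : IsPositive L) (ρ : AddChar L Kˣ) (H : AddSubgroup (Fin m → ℤ)) :
    ∃ t, t ≤ mu (latIdealOn K ρ (H : Set (Fin m → ℤ))) ∧ ∃ u : Fin t → L,
      (∀ i, (u i : Fin m → ℤ) ∈ H) ∧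
      Ideal.span (Set.range fun i => Bpoly K ρ (u i)) = latIdealOn K ρ (H : Set (Fin m → ℤ)) := by
  obtain ⟨f, hf⟩ := Nat.sInf_mem (mu_nonempty (latIdealOn K ρ (H : Set (Fin m → ℤ))))
  exact exists_binomial_gens hpos ρ H _ f hf

theorem latRank_le_mu {K : Type*} [Field K] {L : AddSubgroup (Fin m → ℤ)}
    (hpos : IsPositive L) (ρ : AddChar L Kˣ) (H : AddSubgroup (Fin m → ℤ)) :
    latRank (L ⊓ H) ≤ mu (latIdealOn K ρ (H : Set (Fin m → ℤ))) := by
  obtain ⟨t, ht, u, hu, hspan⟩ := exists_mu_gens (K := K) hpos ρ H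
  rw [latRank_eq _ _ (gens_generate ρ H u hu hspan)]
  exact (finrank_range_le_card _).trans (by simpa using ht)

/-- the combinatorial face property -/
def FaceLike (L : AddSubgroup (Fin m → ℤ)) (E : Set (Fin m)) : Prop :=
  ∀ u ∈ L, (∀ i, i ∉ E → u i ≤ 0) → ∀ i, i ∉ E → u i = 0

theorem face_faceLike (L : AddSubgroup (Fin m → ℤ)) (A : Fin m → Fin n → ℤ) (hA : IsConfig L A)
    (F : Set (Fin n → ℚ)) (hF : IsFace A F) : FaceLike L (EF A F) := by
  obtain ⟨c, hc, rfl⟩ := hF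
  intro u hu hle i hi
  have h0 : ∑ i, u i • A i = 0 := (hA.1 u).2 ⟨1, one_ne_zero, by simpa using hu⟩
  have hcone : ∀ i, ratA A i ∈ cone A := by
    intro i
    refine ⟨Pi.single i 1, fun j => ?_, ?_⟩
    · by_cases h : j = i
      · subst h; simp
      · simp [h]
    · simp [Pi.single_apply]
  set q : Fin m → ℚ := fun i => ∑ j, c j * ratA A i j with hq
  have hq0 : ∀ i, 0 ≤ q i := fun i => hc _ (hcone i)
  have hE : ∀ i, i ∈ EF A (cone A ∩ {x | ∑ j, c j * x j = 0}) ↔ q i = 0 := by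
    intro i
    exact ⟨fun h => h.2, fun h => ⟨hcone i, h⟩⟩
  have hsum : ∑ i, (u i : ℚ) * q i = 0 := by
    simp only [hq, Finset.mul_sum]
    rw [Finset.sum_comm]
    refine Finset.sum_eq_zero fun j _ => ?_
    have h1 := congrFun h0 j
    have h2 : ∑ i, (u i : ℚ) * ratA A i j = 0 := by
      simp only [Finset.sum_apply, Pi.smul_apply, smul_eq_mul, Pi.zero_apply] at h1
      simp only [ratA]
      exact_mod_cast h1
    calc ∑ x, (u x : ℚ) * (c j * ratA A x j) = c j * ∑ i, (u i : ℚ) * ratA A i j := by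
          rw [Finset.mul_sum]; exact Finset.sum_congr rfl fun _ _ => by ring
      _ = 0 := by rw [h2, mul_zero]
  have hall := (Finset.sum_eq_zero_iff_of_nonpos (fun i _ => by
    by_cases h : q i = 0
    · rw [h, mul_zero]
    · exact mul_nonpos_of_nonpos_of_nonneg
        (by exact_mod_cast hle i (fun h' => h ((hE i).1 h'))) (hq0 i))).1 hsum i (Finset.mem_univ _)
  rcases mul_eq_zero.1 hall with h | h
  · exact_mod_cast h
  · exact absurd ((hE i).2 h) hi

open Classical in
/-- set variables outside `E` to zero -/
noncomputable def proj (K : Type*) [Field K] (E : Set (Fin m)) :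
    MvPolynomial (Fin m) K →ₐ[K] MvPolynomial (Fin m) K :=
  aeval fun i => if i ∈ E then X i else 0

theorem proj_monomial_mem (K : Type*) [Field K] (E : Set (Fin m)) (d : Fin m →₀ ℕ) (a : K)
    (h : ∀ i, i ∉ E → d i = 0) : proj K E (monomial d a) = monomial d a := by
  rw [proj, aeval_monomial, monomial_eq]
  congr 1
  refine Finsupp.prod_congr fun i hi => ?_
  by_cases hE : i ∈ E
  · simp [hE]
  · exact absurd (h i hE) (by simpa using hi)

theorem proj_monomial_not (K : Type*) [Field K] (E : Set (Fin m)) (d : Fin m →₀ ℕ) (a : K)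
    (i : Fin m) (hi : i ∉ E) (h : d i ≠ 0) : proj K E (monomial d a) = 0 := by
  rw [proj, aeval_monomial, Finsupp.prod, Finset.prod_eq_zero (i := i)]
  · simp
  · simpa using h
  · simp [hi, h]

theorem proj_Bpoly_mem {K : Type*} [Field K] {L : AddSubgroup (Fin m → ℤ)} (ρ : AddChar L Kˣ)
    (E : Set (Fin m)) (u : L) (hu : (u : Fin m → ℤ) ∈ ZE E) :
    proj K E (Bpoly K ρ u) = Bpoly K ρ u := by
  have hu' : ∀ i, i ∉ E → (u : Fin m → ℤ) i = 0 := hu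
  rw [Bpoly, map_sub, proj_monomial_mem, proj_monomial_mem]
  · intro i hi; simp [np, hu' i hi]
  · intro i hi; simp [pp, hu' i hi]

theorem proj_Bpoly_not {K : Type*} [Field K] {L : AddSubgroup (Fin m → ℤ)} (ρ : AddChar L Kˣ)
    (E : Set (Fin m)) (hE : FaceLike L E) (u : L) (hu : (u : Fin m → ℤ) ∉ ZE E) :
    proj K E (Bpoly K ρ u) = 0 := by
  have h1 : ∃ i, i ∉ E ∧ 0 < (u : Fin m → ℤ) i := by
    by_contra! h
    exact hu (hE _ u.2 h)
  have h2 : ∃ i, i ∉ E ∧ (u : Fin m → ℤ) i < 0 := by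
    by_contra! h
    refine hu fun i hi => ?_
    have := hE _ (neg_mem u.2) (fun i hi => by simpa using h i hi) i hi
    simpa using this
  obtain ⟨i, hi, hi'⟩ := h1
  obtain ⟨j, hj, hj'⟩ := h2
  rw [Bpoly, map_sub, proj_monomial_not K E _ _ i hi, proj_monomial_not K E _ _ j hj, sub_zero]
  · simp [np]; omega
  · simp [pp]; omega

theorem mu_le_of_ci {K : Type*} [Field K] {L : AddSubgroup (Fin m → ℤ)} (hpos : IsPositive L)
    (ρ : AddChar L Kˣ) (h : mu (latIdealOn K ρ ((⊤ : AddSubgroup (Fin m → ℤ)) : Set (Fin m → ℤ)))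
      = latRank L) (E : Set (Fin m)) (hE : FaceLike L E) :
    mu (latIdealOn K ρ (ZE E : Set (Fin m → ℤ))) ≤ latRank (L ⊓ ZE E) := by
  classical
  obtain ⟨t, ht, u, hu, hspan⟩ := exists_mu_gens (K := K) hpos ρ ⊤
  have hcl := gens_generate ρ ⊤ u hu hspan
  rw [inf_top_eq] at hcl
  rw [h, latRank_eq _ _ hcl] at ht
  have hli : LinearIndependent ℤ (fun i => (u i : Fin m → ℤ)) := by
    rw [linearIndependent_iff_card_le_finrank_span]
    simpa using ht
  let J := {i : Fin t // (u i : Fin m → ℤ) ∈ ZE E}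
  let e := (Fintype.equivFin J).symm
  have hgen : Ideal.span (Set.range fun k => Bpoly K ρ (u (e k))) =
      latIdealOn K ρ (ZE E : Set (Fin m → ℤ)) := by
    apply le_antisymm
    · rw [Ideal.span_le]
      rintro _ ⟨k, rfl⟩
      exact Ideal.subset_span ⟨_, (e k).2, rfl⟩
    · refine Ideal.span_le.2 ?_
      rintro _ ⟨v, hv, rfl⟩
      have h1 : Bpoly K ρ v ∈ Ideal.span (Set.range fun i => Bpoly K ρ (u i)) := by
        rw [hspan]; exact Ideal.subset_span ⟨v, trivial, rfl⟩
      have h2 := Ideal.mem_map_of_mem (proj K E) h1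
      rw [proj_Bpoly_mem ρ E v hv, Ideal.map_span] at h2
      refine (Ideal.span_le.2 ?_) h2
      rintro _ ⟨_, ⟨i, rfl⟩, rfl⟩
      by_cases hi : (u i : Fin m → ℤ) ∈ ZE E
      · simp only
        rw [proj_Bpoly_mem ρ E _ hi]
        refine Ideal.subset_span ⟨e.symm ⟨i, hi⟩, ?_⟩
        simp
      · simp only
        rw [proj_Bpoly_not ρ E hE _ hi]
        exact zero_mem _
  have h1 : mu (latIdealOn K ρ (ZE E : Set (Fin m → ℤ))) ≤ Fintype.card J :=
    Nat.sInf_le ⟨_, hgen⟩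
  refine h1.trans ?_
  have hcl2 := gens_generate ρ (ZE E) (fun k => u (e k)) (fun k => (e k).2) hgen
  rw [latRank_eq _ _ hcl2]
  have hli2 : LinearIndependent ℤ (fun k => (u (e k) : Fin m → ℤ)) :=
    hli.comp (fun k => (e k : Fin t)) (Subtype.val_injective.comp e.injective)
  have := linearIndependent_iff_card_le_finrank_span.1 hli2
  simpa using this

/-- Theorem 4.1: `I_{L,ρ}` is a complete intersection (μ = height = rank L)
iff for every face `F` of `σ_L` the lattice ideal `I_{L ∩ ℤ^{𝔼_F},ρ}` is a complete
intersection. -/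
theorem statement7 {K : Type*} [Field K] {m n : ℕ}
    (L : AddSubgroup (Fin m → ℤ)) (ρ : AddChar L Kˣ)
    (hL : L ≠ ⊥) (hpos : IsPositive L)
    (A : Fin m → Fin n → ℤ) (hA : IsConfig L A) :
    mu (latIdeal K ρ) = latRank L ↔
      ∀ F : Set (Fin n → ℚ), IsFace A F →
        mu (latIdealOn K ρ (ZE (EF A F) : Set (Fin m → ℤ))) =
          latRank (L ⊓ ZE (EF A F)) := by
  have htop : latIdeal K ρ =
      latIdealOn K ρ ((⊤ : AddSubgroup (Fin m → ℤ)) : Set (Fin m → ℤ)) := rfl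
  constructor
  · intro h F hF
    rw [htop] at h
    exact le_antisymm (mu_le_of_ci hpos ρ h _ (face_faceLike L A hA F hF))
      (latRank_le_mu hpos ρ _)
  · intro h
    have h1 := h (cone A ∩ {x | ∑ j, (0 : Fin n → ℚ) j * x j = 0})
      ⟨0, by simp, rfl⟩
    have h2 : ZE (EF A (cone A ∩ {x | ∑ j, (0 : Fin n → ℚ) j * x j = 0})) = ⊤ := by
      rw [eq_top_iff]
      intro u _ i hi
      refine absurd ⟨⟨Pi.single i 1, fun j => ?_, ?_⟩, by simp⟩ hi
      · by_cases h : j = i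
        · subst h; simp
        · simp [h]
      · simp [Pi.single_apply]
    rw [h2, inf_top_eq] at h1
    rw [htop]; exact h1

end LatticePaper
end

section
/- Let K be a field of characteristic zero and (L,ρ) a partial character on ℤ^m with L nonzero and positive, such that the configuration of vectors A associated to L is full. Then I_{L,ρ} is either a set-theoretic complete intersection or an almost set-theoretic complete intersection; that is, ara(I_{L,ρ}) ≤ h(I_{L,ρ}) + 1 = rank(L) + 1. -/
open MvPolynomial

namespace LatticePaper

section helpers

lemma addChar_sum {G M ι : Type*} [AddCommGroup G] [CommMonoid M] (χ : AddChar G M)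
    (s : Finset ι) (f : ι → G) : χ (∑ i ∈ s, f i) = ∏ i ∈ s, χ (f i) := by
  classical
  induction s using Finset.induction_on with
  | empty => simp
  | insert a s ha ih => rw [Finset.sum_insert ha, Finset.prod_insert ha, AddChar.map_add_eq_mul, ih]

/-- A monomial evaluated at a point. -/
lemma phi_monomial {K F : Type*} [Field K] [Field F] {m : ℕ}
    (φ : MvPolynomial (Fin m) K →+* F) (a : Fin m →₀ ℕ) (c : K) :
    φ (monomial a c) = φ (C c) * ∏ i, φ (X i) ^ a i := by
  rw [monomial_eq, map_mul, Finsupp.prod_fintype _ _ (by simp), map_prod]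
  simp

/-- Characters that are trivial on `N`-th multiples, detected by one sum. -/
lemma char_trivial {G F : Type*} [AddCommGroup G] [Field F] [CharZero F]
    (χ : AddChar G Fˣ) {k N : ℕ} (b : Fin k → G)
    (hb : Submodule.span ℤ (Set.range b) = ⊤)
    (hN : 0 < N) (hχ : ∀ u, χ u ^ N = 1)
    (hsum : ∑ j : Fin k → Fin N, (((χ (∑ i, (j i : ℕ) • b i) : Fˣ) : F) - 1) = 0) (u : G) :
    χ u = 1 := by
  have key : ∑ j : Fin k → Fin N, ((χ (∑ i, (j i : ℕ) • b i) : Fˣ) : F)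
      = ∏ i, ∑ a : Fin N, ((χ (b i) : Fˣ) : F) ^ (a : ℕ) := by
    rw [Finset.prod_univ_sum, Fintype.piFinset_univ]
    refine Finset.sum_congr rfl fun j _ => ?_
    rw [addChar_sum]
    simp [AddChar.map_nsmul_eq_pow]
  rw [Finset.sum_sub_distrib, key, sub_eq_zero] at hsum
  have hne : ∏ i, ∑ a : Fin N, ((χ (b i) : Fˣ) : F) ^ (a : ℕ) ≠ 0 := by
    rw [hsum]
    simp [hN.ne']
  have hgen : ∀ i, χ (b i) = 1 := by
    intro i
    have h1 := Finset.prod_ne_zero_iff.1 hne i (Finset.mem_univ _)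
    rw [Fin.sum_univ_eq_sum_range (fun a => ((χ (b i) : Fˣ) : F) ^ a)] at h1
    have h2 := geom_sum_mul ((χ (b i) : Fˣ) : F) N
    have h3 : ((χ (b i) : Fˣ) : F) ^ N = 1 := by
      rw [← Units.val_pow_eq_pow_val, hχ]; simp
    rw [h3, sub_self] at h2
    have h4 := (mul_eq_zero.1 h2).resolve_left h1
    exact Units.ext (by simpa [sub_eq_zero] using h4)
  have hu : u ∈ Submodule.span ℤ (Set.range b) := by rw [hb]; trivial
  induction hu using Submodule.span_induction with
  | mem x hx => obtain ⟨i, rfl⟩ := hx; exact hgen i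
  | zero => simp
  | add x y _ _ hx hy => rw [AddChar.map_add_eq_mul, hx, hy, one_mul]
  | smul a x _ hx => rw [AddChar.map_zsmul_eq_zpow, hx, one_zpow]

/-- The vectors `N e_i - ∑_{k ∈ T} c_{ik} e_k`. -/
def vv {m : ℕ} (T : Finset (Fin m)) (N : ℕ) (c : Fin m → Fin m → ℕ) (i : Fin m) : Fin m → ℤ :=
  fun j => if j = i then (N : ℤ) else if j ∈ T then -(c i j : ℤ) else 0

/-- The last equation. -/
noncomputable def gpoly {K : Type*} [Field K] {m : ℕ} {L : AddSubgroup (Fin m → ℤ)}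
    (ρ : AddChar L Kˣ) {J : Type*} [Fintype J] (w : J → L) : MvPolynomial (Fin m) K :=
  ∑ j, monomial ((∑ l, np (w l : Fin m → ℤ)) - np (w j : Fin m → ℤ)) (((ρ (w j))⁻¹ : Kˣ) : K)
    * Bpoly K ρ (w j)

lemma gpoly_mem {K : Type*} [Field K] {m : ℕ} {L : AddSubgroup (Fin m → ℤ)}
    (ρ : AddChar L Kˣ) {J : Type*} [Fintype J] (w : J → L) : gpoly ρ w ∈ latIdeal K ρ :=
  Ideal.sum_mem _ fun j _ => Ideal.mul_mem_left _ _ (Ideal.subset_span ⟨w j, trivial, rfl⟩)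

/-- The character attached to a torus point, divided by `ρ`. -/
noncomputable def chiOf {K F : Type*} [Field K] [Field F] {m : ℕ} {L : AddSubgroup (Fin m → ℤ)}
    (ρ : AddChar L Kˣ) (f : K →+* F) (y : Fin m → Fˣ) : AddChar L Fˣ where
  toFun u := (∏ i, y i ^ ((u : Fin m → ℤ) i)) * (Units.map (f : K →* F) (ρ u))⁻¹
  map_zero_eq_one' := by simp
  map_add_eq_mul' := by
    intro a b
    simp only [AddChar.map_add_eq_mul, map_mul, mul_inv, AddSubgroup.coe_add, Pi.add_apply,
      zpow_add, Finset.prod_mul_distrib]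
    exact mul_mul_mul_comm _ _ _ _

lemma phi_Bpoly_torus {K F : Type*} [Field K] [Field F] {m : ℕ} {L : AddSubgroup (Fin m → ℤ)}
    (ρ : AddChar L Kˣ) (φ : MvPolynomial (Fin m) K →+* F) (y : Fin m → Fˣ)
    (hy : ∀ i, φ (X i) = y i) (u : L) :
    φ (Bpoly K ρ u) = φ (C (ρ u : K)) * (∏ i, φ (X i) ^ np (u : Fin m → ℤ) i) *
      ((chiOf ρ (φ.comp C) y u : Fˣ) - 1 : F) := by
  have hρ : φ (C (ρ u : K)) ≠ 0 := by
    have : (φ.comp C) (ρ u : K) ≠ 0 := (map_ne_zero _).2 (ρ u).ne_zero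
    exact this
  have h : (∏ i, (y i : F) ^ pp (u : Fin m → ℤ) i)
      = (∏ i, (y i : F) ^ np (u : Fin m → ℤ) i) * ∏ i, (y i : F) ^ ((u : Fin m → ℤ) i) := by
    rw [← Finset.prod_mul_distrib]
    refine Finset.prod_congr rfl fun i _ => ?_
    rw [← zpow_natCast, ← zpow_natCast, ← zpow_add₀ (y i).ne_zero]
    congr 1
    simp only [pp, np, Finsupp.equivFunOnFinite_symm_apply_apply]
    omega
  have hc : ((chiOf ρ (φ.comp C) y u : Fˣ) : F)
      = (∏ i, (y i : F) ^ ((u : Fin m → ℤ) i)) * (φ (C (ρ u : K)))⁻¹ := by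
    simp [chiOf]
  rw [Bpoly, map_sub, phi_monomial, phi_monomial, hc]
  simp only [hy, h, map_one]
  field_simp

lemma phi_gpoly_torus {K F : Type*} [Field K] [Field F] {m : ℕ} {L : AddSubgroup (Fin m → ℤ)}
    (ρ : AddChar L Kˣ) (φ : MvPolynomial (Fin m) K →+* F) (y : Fin m → Fˣ)
    (hy : ∀ i, φ (X i) = y i) {J : Type*} [Fintype J] (w : J → L) :
    φ (gpoly ρ w) = (∏ i, φ (X i) ^ (∑ l, np (w l : Fin m → ℤ)) i) *
      ∑ j, ((chiOf ρ (φ.comp C) y (w j) : Fˣ) - 1 : F) := by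
  rw [gpoly, map_sum, Finset.mul_sum]
  refine Finset.sum_congr rfl fun j _ => ?_
  rw [map_mul, phi_Bpoly_torus ρ φ y hy, phi_monomial]
  have h1 : φ (C (((ρ (w j))⁻¹ : Kˣ) : K)) * φ (C (ρ (w j) : K)) = 1 := by
    rw [← map_mul, ← map_mul]; simp
  have hle : np (w j : Fin m → ℤ) ≤ ∑ l, np (w l : Fin m → ℤ) :=
    Finset.single_le_sum (f := fun l => np (w l : Fin m → ℤ)) (fun _ _ => by simp)
      (Finset.mem_univ j)
  have h2 : (∏ i, φ (X i) ^ ((∑ l, np (w l : Fin m → ℤ)) - np (w j : Fin m → ℤ)) i) *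
      (∏ i, φ (X i) ^ np (w j : Fin m → ℤ) i) = ∏ i, φ (X i) ^ (∑ l, np (w l : Fin m → ℤ)) i := by
    rw [← Finset.prod_mul_distrib]
    refine Finset.prod_congr rfl fun i _ => ?_
    rw [← pow_add, ← Finsupp.add_apply, tsub_add_cancel_of_le hle]
  rw [← h2]
  linear_combination (∏ i, φ (X i) ^ ((∑ l, np (w l : Fin m → ℤ)) - np (w j : Fin m → ℤ)) i) *
      (∏ i, φ (X i) ^ np (w j : Fin m → ℤ) i) *
      ((chiOf ρ (φ.comp C) y (w j) : Fˣ) - 1 : F) * h1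

/-- Set-theoretic core at a point. -/
lemma point_core {K F : Type*} [Field K] [CharZero K] [Field F] {m : ℕ}
    {L : AddSubgroup (Fin m → ℤ)} (ρ : AddChar L Kˣ)
    (T : Finset (Fin m)) (N : ℕ) (hN : 0 < N) (c : Fin m → Fin m → ℕ)
    (hc : ∀ i ∉ T, ∀ k ∈ T, 0 < c i k)
    (hv : ∀ i ∉ T, vv T N c i ∈ L)
    (hrel : ∀ u ∈ L, ∀ k ∈ T, (N : ℤ) * u k + ∑ i ∈ Tᶜ, u i * c i k = 0)
    {q : ℕ} (b : Fin q → L) (hb : Submodule.span ℤ (Set.range b) = ⊤)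
    (φ : MvPolynomial (Fin m) K →+* F)
    (hf : ∀ i (hi : i ∉ T), φ (Bpoly K ρ ⟨vv T N c i, hv i hi⟩) = 0)
    (hg : φ (gpoly ρ (fun j : Fin q → Fin N => ∑ i, (j i : ℕ) • b i)) = 0) (u : L) :
    φ (Bpoly K ρ u) = 0 := by
  have hC : ∀ z : Kˣ, φ (C (z : K)) ≠ 0 := fun z => by
    have : (φ.comp C) (z : K) ≠ 0 := (map_ne_zero _).2 z.ne_zero
    exact this
  by_cases h0 : ∃ i, φ (X i) = 0
  · -- boundary points
    -- the equation at `v_i`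
    have heq : ∀ i (hi : i ∉ T), φ (X i) ^ N
        = φ (C (ρ ⟨vv T N c i, hv i hi⟩ : K)) * ∏ k ∈ T, φ (X k) ^ c i k := by
      intro i hi
      have h := hf i hi
      rw [Bpoly, map_sub, phi_monomial, phi_monomial, sub_eq_zero] at h
      have e1 : ∏ j, φ (X j) ^ pp (vv T N c i) j = φ (X i) ^ N := by
        rw [Finset.prod_eq_single i]
        · simp [pp, vv]
        · intro j _ hj
          have : pp (vv T N c i) j = 0 := by
            simp only [pp, vv, Finsupp.equivFunOnFinite_symm_apply_apply, if_neg hj]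
            split_ifs <;> simp
          rw [this, pow_zero]
        · simp
      have e2 : ∏ j, φ (X j) ^ np (vv T N c i) j = ∏ k ∈ T, φ (X k) ^ c i k := by
        symm
        rw [← Finset.prod_subset (Finset.subset_univ T)]
        · refine Finset.prod_congr rfl fun k hk => ?_
          have : k ≠ i := fun h => hi (h ▸ hk)
          simp [np, vv, this, hk]
        · intro j _ hj
          have : np (vv T N c i) j = 0 := by
            simp only [np, vv, Finsupp.equivFunOnFinite_symm_apply_apply, if_neg hj]
            split_ifs <;> simp
          rw [this, pow_zero]
      simpa [e1, e2] using h
    have hk : ∃ k ∈ T, φ (X k) = 0 := by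
      obtain ⟨i, hi⟩ := h0
      by_cases hiT : i ∈ T
      · exact ⟨i, hiT, hi⟩
      · have h := heq i hiT
        rw [hi, zero_pow hN.ne'] at h
        have h' := (mul_eq_zero.1 h.symm).resolve_left (hC _)
        obtain ⟨k, hk, hk0⟩ := Finset.prod_eq_zero_iff.1 h'
        exact ⟨k, hk, eq_zero_of_pow_eq_zero hk0⟩
    obtain ⟨k, hkT, hk0⟩ := hk
    have hz : ∀ i, i ∉ T → φ (X i) = 0 := by
      intro i hi
      have h := heq i hi
      rw [Finset.prod_eq_zero hkT (by rw [hk0, zero_pow (hc i hi k hkT).ne']), mul_zero] at h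
      exact eq_zero_of_pow_eq_zero h
    have claim : ∀ w ∈ L, w ≠ 0 → ∃ i, φ (X i) = 0 ∧ 0 < w i := by
      intro w hw hw0
      by_contra hcon
      push Not at hcon
      have hle : ∀ i, i ∉ T → w i ≤ 0 := fun i hi => hcon i (hz i hi)
      have hwk := hcon k hk0
      have hr := hrel w hw k hkT
      have hterm : ∀ i ∈ Tᶜ, w i * (c i k : ℤ) ≤ 0 := fun i hi =>
        mul_nonpos_of_nonpos_of_nonneg (hle i (by simpa using hi)) (by positivity)
      have hs := Finset.sum_nonpos hterm
      have hNz : (0 : ℤ) < N := by exact_mod_cast hN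
      have hs0 : ∑ i ∈ Tᶜ, w i * (c i k : ℤ) = 0 := by nlinarith
      have hall := (Finset.sum_eq_zero_iff_of_nonpos hterm).1 hs0
      have hwi : ∀ i, i ∉ T → w i = 0 := by
        intro i hi
        have := hall i (by simpa using hi)
        have hcp := hc i hi k hkT
        rcases mul_eq_zero.1 this with h | h
        · exact h
        · exfalso; omega
      apply hw0
      funext i
      by_cases hi : i ∈ T
      · have := hrel w hw i hi
        rw [Finset.sum_eq_zero (fun j hj => by rw [hwi j (by simpa using hj), zero_mul]),
          add_zero] at this
        exact (mul_eq_zero.1 this).resolve_left hNz.ne'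
      · exact hwi i hi
    by_cases hu : u = 0
    · subst hu
      have : Bpoly K ρ (0 : L) = 0 := by
        simp [Bpoly, pp, np]
      rw [this, map_zero]
    · have hu' : (u : Fin m → ℤ) ≠ 0 := fun h => hu (Subtype.ext h)
      obtain ⟨i, hi, hip⟩ := claim u u.2 hu'
      obtain ⟨j, hj, hjp⟩ := claim (-u) (L.neg_mem u.2) (neg_ne_zero.2 hu')
      rw [Bpoly, map_sub, phi_monomial, phi_monomial, 
        Finset.prod_eq_zero (Finset.mem_univ i), Finset.prod_eq_zero (Finset.mem_univ j)]
      · simp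
      · rw [hj, zero_pow]
        simp only [np, Finsupp.equivFunOnFinite_symm_apply_apply]
        simp only [Pi.neg_apply] at hjp
        omega
      · rw [hi, zero_pow]
        simp only [pp, Finsupp.equivFunOnFinite_symm_apply_apply]
        omega
  · push Not at h0
    let y : Fin m → Fˣ := fun i => Units.mk0 _ (h0 i)
    have hy : ∀ i, φ (X i) = y i := fun i => rfl
    have hprod : ∀ a : Fin m →₀ ℕ, ∏ i, φ (X i) ^ a i ≠ 0 := fun a =>
      Finset.prod_ne_zero_iff.2 fun i _ => pow_ne_zero _ (h0 i)
    have : CharZero F := charZero_of_injective_ringHom (φ.comp C).injective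
    have hχv : ∀ i (hi : i ∉ T), chiOf ρ (φ.comp C) y ⟨vv T N c i, hv i hi⟩ = 1 := by
      intro i hi
      have h := hf i hi
      rw [phi_Bpoly_torus ρ φ y hy] at h
      have := (mul_eq_zero.1 h).resolve_left (mul_ne_zero (hC _) (hprod _))
      exact Units.ext (by simpa [sub_eq_zero] using this)
    have hχN : ∀ w, chiOf ρ (φ.comp C) y w ^ N = 1 := by
      intro w
      have hw : N • w = ∑ i : {i // i ∉ T}, (w : Fin m → ℤ) i • 
          (⟨vv T N c i, hv i i.2⟩ : L) := by
        apply Subtype.ext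
        funext j
        simp only [AddSubgroup.coe_nsmul, AddSubgroup.val_finsetSum, AddSubgroup.coe_zsmul,
          Finset.sum_apply, Pi.smul_apply, nsmul_eq_mul, smul_eq_mul]
        rw [← Finset.sum_subtype (Tᶜ) (by simp) (fun i => (w : Fin m → ℤ) i * vv T N c i j)]
        by_cases hj : j ∈ T
        · have := hrel w w.2 j hj
          have e : ∑ i ∈ Tᶜ, (w : Fin m → ℤ) i * vv T N c i j 
              = - ∑ i ∈ Tᶜ, (w : Fin m → ℤ) i * c i j := by
            rw [← Finset.sum_neg_distrib]
            refine Finset.sum_congr rfl fun i hi => ?_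
            have : j ≠ i := fun h => by subst h; simp [hj] at hi
            simp [vv, this, hj]
          rw [e]; linarith
        · rw [Finset.sum_eq_single j]
          · simp [vv, mul_comm]
          · intro i _ hij
            simp [vv, hij.symm, hj]
          · intro h; simp [hj] at h
      rw [← AddChar.map_nsmul_eq_pow, hw, addChar_sum]
      refine Finset.prod_eq_one fun i _ => ?_
      rw [AddChar.map_zsmul_eq_zpow, hχv i i.2, one_zpow]
    rw [phi_gpoly_torus ρ φ y hy] at hg
    have hg' := (mul_eq_zero.1 hg).resolve_left (hprod _)
    rw [phi_Bpoly_torus ρ φ y hy, char_trivial _ b hb hN hχN hg' u]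
    simp

lemma ara_core {K : Type*} [Field K] [CharZero K] {m : ℕ}
    {L : AddSubgroup (Fin m → ℤ)} (ρ : AddChar L Kˣ)
    (T : Finset (Fin m)) (N : ℕ) (hN : 0 < N) (c : Fin m → Fin m → ℕ)
    (hc : ∀ i ∉ T, ∀ k ∈ T, 0 < c i k)
    (hv : ∀ i ∉ T, vv T N c i ∈ L)
    (hrel : ∀ u ∈ L, ∀ k ∈ T, (N : ℤ) * u k + ∑ i ∈ Tᶜ, u i * c i k = 0) :
    ara (latIdeal K ρ) ≤ latRank L + 1 := by
  have hfin : Module.Finite ℤ L := 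
    inferInstanceAs (Module.Finite ℤ (AddSubgroup.toIntSubmodule L))
  obtain ⟨q, b, hb⟩ := Module.Finite.exists_fin (R := ℤ) (M := L)
  let f' : Option {i // i ∉ T} → MvPolynomial (Fin m) K := fun o =>
    o.elim (gpoly ρ (fun j : Fin q → Fin N => ∑ i, (j i : ℕ) • b i))
      (fun i => Bpoly K ρ ⟨vv T N c i, hv i i.2⟩)
  have hmem : ∀ o, f' o ∈ latIdeal K ρ := by
    rintro (_ | i)
    · exact gpoly_mem _ _
    · exact Ideal.subset_span ⟨_, trivial, rfl⟩
  have hrad : (Ideal.span (Set.range f')).radical = (latIdeal K ρ).radical := by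
    apply le_antisymm
    · refine Ideal.radical_mono (Ideal.span_le.2 ?_)
      rintro _ ⟨o, rfl⟩
      exact hmem o
    · rw [← Ideal.radical_idem (Ideal.span (Set.range f'))]
      refine Ideal.radical_mono (Ideal.span_le.2 ?_)
      rintro _ ⟨u, -, rfl⟩
      rw [SetLike.mem_coe, Ideal.radical_eq_sInf, Ideal.mem_sInf]
      rintro P ⟨hP, hPp⟩
      let φ : MvPolynomial (Fin m) K →+* FractionRing (MvPolynomial (Fin m) K ⧸ P) :=
        (algebraMap (MvPolynomial (Fin m) K ⧸ P) _).comp (Ideal.Quotient.mk P)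
      have hφ : ∀ p, φ p = 0 ↔ p ∈ P := by
        intro p
        simp only [φ, RingHom.comp_apply]
        rw [map_eq_zero_iff _ (IsFractionRing.injective _ _), Ideal.Quotient.eq_zero_iff_mem]
      have hf' : ∀ o, φ (f' o) = 0 := fun o => (hφ _).2 (hP (Ideal.subset_span ⟨o, rfl⟩))
      exact (hφ _).1 (point_core ρ T N hN c hc hv hrel b hb φ
        (fun i hi => hf' (some ⟨i, hi⟩)) (hf' none) u)
  have hcard : Fintype.card {i // i ∉ T} ≤ latRank L := by
    have hli : LinearIndependent ℤ (fun i : {i // i ∉ T} => 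
        (⟨vv T N c i, hv i i.2⟩ : AddSubgroup.toIntSubmodule L)) := by
      rw [Fintype.linearIndependent_iff]
      intro g hg i
      have h := congrArg (fun z : AddSubgroup.toIntSubmodule L => (z : Fin m → ℤ) i) hg
      simp only [Submodule.coe_sum, Submodule.coe_smul, Finset.sum_apply, Pi.smul_apply,
        smul_eq_mul, Submodule.coe_zero, Pi.zero_apply] at h
      rw [Finset.sum_eq_single i] at h
      · simp only [vv, if_true] at h
        exact (mul_eq_zero.1 h).resolve_right (by exact_mod_cast hN.ne')
      · intro j _ hj
        have : (i : Fin m) ≠ j := fun h => hj (Subtype.ext h.symm)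
        simp [vv, this, i.2]
      · simp
    exact hli.fintype_card_le_finrank
  let e := (Fintype.equivFin (Option {i // i ∉ T})).symm
  have : ara (latIdeal K ρ) ≤ Fintype.card (Option {i // i ∉ T}) := by
    refine Nat.sInf_le ⟨f' ∘ e, fun i => hmem _, ?_⟩
    rw [e.surjective.range_comp, hrad]
  rw [Fintype.card_option] at this
  omega

end helpers

/-- Theorem 4.4, characteristic zero: if the configuration associated to `L`
is full, then `I_{L,ρ}` is a set-theoretic complete intersection or an almost set-theoretic
complete intersection: `ara I_{L,ρ} ≤ rank L + 1`. -/
theorem statement10 {K : Type*} [Field K] [CharZero K] {m n : ℕ}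
    (L : AddSubgroup (Fin m → ℤ)) (ρ : AddChar L Kˣ)
    (hL : L ≠ ⊥) (hpos : IsPositive L)
    (A : Fin m → Fin n → ℤ) (hA : IsConfig L A)
    (hnm : n ≤ m) (hfull : IsFull hnm A) :
    ara (latIdeal K ρ) ≤ latRank L + 1 := by
  obtain ⟨hli, -, hint⟩ := hfull
  -- rational coordinates, indexed by all of `Fin m`
  have hex : ∀ i : Fin m, ∃ lam : Fin n → ℚ, (n ≤ (i : ℕ) → ∀ k, 0 < lam k) ∧
      ((i : ℕ) < n → ∀ k, lam k = if Fin.castLE hnm k = i then 1 else 0) ∧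
      ratA A i = ∑ k, lam k • ratA A (Fin.castLE hnm k) := by
    intro i
    by_cases h : n ≤ (i : ℕ)
    · obtain ⟨lam, h1, h2⟩ := hint i h
      exact ⟨lam, fun _ => h1, fun h' => by omega, h2⟩
    · refine ⟨fun k => if Fin.castLE hnm k = i then 1 else 0, fun h' => absurd h' h,
        fun _ _ => rfl, ?_⟩
      rw [Finset.sum_eq_single (⟨i, by omega⟩ : Fin n)]
      · simp
      · intro k _ hk
        have : Fin.castLE hnm k ≠ i := fun hh => hk (Fin.ext (by simp [← hh]))
        simp [this]
      · simp
  choose lam hlpos hlT hlA using hex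
  have hsat : ∀ u : Fin m → ℤ, (∑ i, u i • A i) = 0 ↔ ∀ k, ∑ i, (u i : ℚ) * lam i k = 0 := by
    intro u
    have e1 : (∑ i, u i • A i) = 0 ↔ ∑ i, (u i : ℚ) • ratA A i = 0 := by
      constructor
      · intro h
        funext j
        have := congrFun h j
        simp only [Finset.sum_apply, Pi.smul_apply, smul_eq_mul, Pi.zero_apply, ratA] at this ⊢
        exact_mod_cast this
      · intro h
        funext j
        have := congrFun h j
        simp only [Finset.sum_apply, Pi.smul_apply, smul_eq_mul, Pi.zero_apply, ratA] at this ⊢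
        exact_mod_cast this
    have e2 : ∑ i, (u i : ℚ) • ratA A i
        = ∑ k, (∑ i, (u i : ℚ) * lam i k) • ratA A (Fin.castLE hnm k) := by
      simp_rw [Finset.sum_smul]
      rw [Finset.sum_comm]
      refine Finset.sum_congr rfl fun i _ => ?_
      conv_lhs => rw [hlA i]
      rw [Finset.smul_sum]
      simp_rw [mul_smul]
    rw [e1, e2]
    constructor
    · exact Fintype.linearIndependent_iff.1 hli _
    · intro h; simp [h]
  -- common denominator
  obtain ⟨D, hD, cz, hcz⟩ : ∃ D : ℕ, 0 < D ∧ ∃ cz : Fin m → Fin n → ℤ,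
      ∀ i k, (cz i k : ℚ) = D * lam i k := by
    refine ⟨∏ i, ∏ k, (lam i k).den, Finset.prod_pos fun i _ => Finset.prod_pos fun k _ =>
      (lam i k).pos, ?_⟩
    have : ∀ i k, ∃ z : ℤ, (z : ℚ) = ((∏ i, ∏ k, (lam i k).den : ℕ) : ℚ) * lam i k := by
      intro i k
      obtain ⟨t, ht⟩ : (lam i k).den ∣ ∏ i, ∏ k, (lam i k).den :=
        (Finset.dvd_prod_of_mem (fun k => (lam i k).den) (Finset.mem_univ k)).trans
          (Finset.dvd_prod_of_mem (fun i => ∏ k, (lam i k).den) (Finset.mem_univ i))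
      refine ⟨t * (lam i k).num, ?_⟩
      rw [ht]
      have := Rat.mul_den_eq_num (lam i k)
      push_cast
      rw [← this]; ring
    choose cz hcz using this
    exact ⟨cz, hcz⟩
  let T : Finset (Fin m) := Finset.univ.filter fun i => (i : ℕ) < n
  have hT : ∀ i, i ∈ T ↔ (i : ℕ) < n := by simp [T]
  let c0 : Fin m → Fin m → ℕ := fun i j => if h : (j : ℕ) < n then (cz i ⟨j, h⟩).toNat else 0
  have hczpos : ∀ i, i ∉ T → ∀ k, 0 < cz i k := by
    intro i hi k
    have h1 := hlpos i (by rw [hT] at hi; omega) k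
    have : (0 : ℚ) < cz i k := by
      rw [hcz]
      have : (0 : ℚ) < D := by exact_mod_cast hD
      positivity
    exact_mod_cast this
  have hc0 : ∀ i, i ∉ T → ∀ k : Fin n, (c0 i (Fin.castLE hnm k) : ℤ) = cz i k := by
    intro i hi k
    have := hczpos i hi k
    simp [c0, this.le]
  have hsum : ∀ (u : Fin m → ℤ) (k : Fin n), ((D : ℤ) * u (Fin.castLE hnm k) +
      ∑ i ∈ Tᶜ, u i * (c0 i (Fin.castLE hnm k) : ℤ) : ℤ) = D * ∑ i, (u i : ℚ) * lam i k := by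
    intro u k
    rw [← Finset.sum_add_sum_compl T]
    have e1 : ∑ i ∈ T, (u i : ℚ) * lam i k = u (Fin.castLE hnm k) := by
      rw [Finset.sum_eq_single (Fin.castLE hnm k)]
      · rw [hlT _ (by simp)]; simp
      · intro j hj hjk
        rw [hlT j ((hT j).1 hj), if_neg hjk.symm, mul_zero]
      · intro h
        exact absurd ((hT _).2 (by simp)) h
    have e2 : (((∑ i ∈ Tᶜ, u i * (c0 i (Fin.castLE hnm k) : ℤ)) : ℤ) : ℚ)
        = D * ∑ i ∈ Tᶜ, (u i : ℚ) * lam i k := by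
      rw [Int.cast_sum, Finset.mul_sum]
      refine Finset.sum_congr rfl fun i hi => ?_
      rw [hc0 i (by simpa using hi) k, Int.cast_mul, hcz]
      ring
    rw [e1, Int.cast_add, e2]
    push_cast
    ring
  have hw : ∀ i, i ∉ T → ∃ d : ℤ, d ≠ 0 ∧ d • vv T D c0 i ∈ L := by
    intro i hi
    rw [← hA.1, hsat]
    intro k
    have h := hsum (vv T D c0 i) k
    have hne : Fin.castLE hnm k ≠ i := fun h => hi (h ▸ (hT _).2 (by simp))
    have hkT : Fin.castLE hnm k ∈ T := (hT _).2 (by simp)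
    rw [Finset.sum_eq_single i] at h
    · simp only [vv, if_neg hne, if_pos hkT, if_true] at h
      rw [mul_neg, neg_add_cancel, Int.cast_zero] at h
      exact (mul_eq_zero.1 h.symm).resolve_left (by exact_mod_cast hD.ne')
    · intro j hj hji
      have : j ∉ T := by simpa using hj
      simp [vv, hji, this]
    · intro h; simp [hi] at h
  -- common multiple
  obtain ⟨d, hd, hdL⟩ : ∃ d : ℕ, 0 < d ∧ ∀ i, i ∉ T → d • vv T D c0 i ∈ L := by
    have : ∀ i, ∃ d : ℕ, 0 < d ∧ (i ∉ T → d • vv T D c0 i ∈ L) := by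
      intro i
      by_cases hi : i ∈ T
      · exact ⟨1, one_pos, fun h => absurd hi h⟩
      · obtain ⟨d, hd, hdL⟩ := hw i hi
        refine ⟨d.natAbs, Int.natAbs_pos.2 hd, fun _ => ?_⟩
        rw [← natCast_zsmul]
        rcases Int.natAbs_eq d with h | h
        · rwa [← h]
        · have : ((d.natAbs : ℕ) : ℤ) = -d := by omega
          rw [this, neg_smul]
          exact L.neg_mem hdL
    choose d hd hdL using this
    refine ⟨∏ i, d i, Finset.prod_pos fun i _ => hd i, fun i hi => ?_⟩
    obtain ⟨t, ht⟩ := Finset.dvd_prod_of_mem d (Finset.mem_univ i)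
    rw [ht, mul_comm, mul_smul]
    exact L.nsmul_mem (hdL i hi) t
  refine ara_core ρ T (d * D) (Nat.mul_pos hd hD) (fun i j => d * c0 i j) ?_ ?_ ?_
  · intro i hi k hk
    refine Nat.mul_pos hd ?_
    have h1 := hc0 i hi ⟨k, (hT k).1 hk⟩
    have h2 := hczpos i hi ⟨k, (hT k).1 hk⟩
    have h3 : Fin.castLE hnm ⟨k, (hT k).1 hk⟩ = k := rfl
    rw [h3] at h1
    omega
  · intro i hi
    have : vv T (d * D) (fun i j => d * c0 i j) i = d • vv T D c0 i := by
      funext j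
      simp only [vv, Pi.smul_apply]
      split_ifs <;> simp
    rw [this]
    exact hdL i hi
  · intro u hu k hk
    have h1 : (∑ i, u i • A i) = 0 := (hA.1 u).2 ⟨1, one_ne_zero, by simpa using hu⟩
    have h2 := hsum u ⟨k, (hT k).1 hk⟩
    rw [(hsat u).1 h1, mul_zero] at h2
    have h3 : Fin.castLE hnm ⟨k, (hT k).1 hk⟩ = k := rfl
    rw [h3] at h2
    have h4 : (D : ℤ) * u k + ∑ i ∈ Tᶜ, u i * (c0 i k : ℤ) = 0 := by exact_mod_cast h2
    have h5 : ((d * D : ℕ) : ℤ) * u k + ∑ i ∈ Tᶜ, u i * ((d * c0 i k : ℕ) : ℤ)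
        = d * ((D : ℤ) * u k + ∑ i ∈ Tᶜ, u i * (c0 i k : ℤ)) := by
      rw [mul_add, Finset.mul_sum]
      push_cast
      congr 1
      · ring
      · exact Finset.sum_congr rfl fun i _ => by ring
    rw [h5, h4, mul_zero]

end LatticePaper
end

section
/- Let K be a field of characteristic p > 0 and (L,ρ) a partial character on ℤ^m with L nonzero and positive, such that the configuration of vectors A associated to L is full. Then I_{L,ρ} is a set-theoretic complete intersection; that is, ara(I_{L,ρ}) = h(I_{L,ρ}) = rank(L) = m − n, and in fact rad(I_{L,ρ}) is the radical of an ideal generated by m − n binomials of I_{L,ρ}. -/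
open MvPolynomial

namespace LatticePaper

/-! ### Rank of the lattice -/

lemma rank_aux {m n : ℕ} (L : AddSubgroup (Fin m → ℤ)) (A : Fin m → Fin n → ℤ)
    (hA : IsConfig L A) : latRank L = m - n := by
  classical
  let φ : (Fin m → ℤ) →ₗ[ℤ] (Fin n → ℤ) := Fintype.linearCombination ℤ A
  have hφ : ∀ u, φ u = ∑ i, u i • A i := fun u => Fintype.linearCombination_apply ℤ A u
  have hsurj : LinearMap.range φ = ⊤ := by
    rw [LinearMap.range_eq_top]
    intro y
    obtain ⟨u, hu⟩ := hA.2 y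
    exact ⟨u, by rw [hφ]; exact hu⟩
  have h1 := (LinearMap.ker φ).finrank_quotient_add_finrank
  rw [φ.quotKerEquivRange.finrank_eq, hsurj, finrank_top] at h1
  simp only [Module.finrank_fin_fun] at h1
  have hle : AddSubgroup.toIntSubmodule L ≤ LinearMap.ker φ := by
    intro u hu
    rw [LinearMap.mem_ker, hφ, hA.1]
    exact ⟨1, one_ne_zero, by rw [one_smul]; exact hu⟩
  have h2 : latRank L ≤ Module.finrank ℤ (LinearMap.ker φ) := Submodule.finrank_mono hle
  have h3 : Module.finrank ℤ (LinearMap.ker φ) ≤ latRank L := by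
    let b := Module.finBasis ℤ (LinearMap.ker φ)
    have hd : ∀ i, ∃ d : ℤ, d ≠ 0 ∧ d • ((b i : LinearMap.ker φ) : Fin m → ℤ) ∈ L := by
      intro i
      rw [← hA.1, ← hφ]
      exact (b i).2
    choose d hd0 hdL using hd
    let D := ∏ i, d i
    have hD0 : D ≠ 0 := Finset.prod_ne_zero_iff.mpr fun i _ => hd0 i
    have hDL : ∀ x : LinearMap.ker φ, D • (x : Fin m → ℤ) ∈ AddSubgroup.toIntSubmodule L := by
      intro x
      rw [← b.sum_repr x]
      push_cast
      rw [Finset.smul_sum]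
      refine Submodule.sum_mem _ fun i _ => ?_
      rw [smul_comm]
      refine Submodule.smul_mem _ _ ?_
      have : D = (∏ j ∈ Finset.univ.erase i, d j) * d i :=
        (Finset.prod_erase_mul _ _ (Finset.mem_univ i)).symm
      rw [this, mul_smul]
      exact Submodule.smul_mem _ _ (hdL i)
    let g : LinearMap.ker φ →ₗ[ℤ] AddSubgroup.toIntSubmodule L :=
      LinearMap.codRestrict _ (D • (LinearMap.ker φ).subtype) (fun x => hDL x)
    have hg : Function.Injective g := by
      intro x y hxy
      have := congrArg Subtype.val hxy
      have h4 : D • (x : Fin m → ℤ) = D • (y : Fin m → ℤ) := this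
      exact Subtype.ext (smul_right_injective _ hD0 h4)
    exact LinearMap.finrank_le_finrank_of_injective hg
  omega

/-! ### Height of the origin -/

/-- Kill the variables with index below `j`. -/
noncomputable def killVars (K : Type*) [Field K] (m j : ℕ) :
    MvPolynomial (Fin m) K →ₐ[K] MvPolynomial (Fin m) K :=
  aeval fun i => if (i : ℕ) < j then 0 else X i

lemma killVars_X (K : Type*) [Field K] (m j : ℕ) (i : Fin m) :
    killVars K m j (X i) = if (i : ℕ) < j then 0 else X i := by
  simp [killVars]

lemma height_aux (K : Type*) [Field K] (m : ℕ) : ∀ j ≤ m,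
    (j : ℕ∞) ≤ (RingHom.ker (killVars K m j)).height := by
  intro j
  induction j with
  | zero => intro _; simp
  | succ j ih =>
    intro hj
    have h0 := ih (by omega)
    haveI : (RingHom.ker (killVars K m j)).IsPrime := RingHom.ker_isPrime _
    haveI : (RingHom.ker (killVars K m (j+1))).IsPrime := RingHom.ker_isPrime _
    have hcomp : (killVars K m (j+1)).comp (killVars K m j) = killVars K m (j+1) := by
      apply MvPolynomial.algHom_ext
      intro i
      rw [AlgHom.comp_apply, killVars_X, killVars_X]
      split_ifs with h1 h2 h2
      · simp
      · omega
      · simp [killVars_X, h2]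
      · simp [killVars_X, h2]
    have hlt : RingHom.ker (killVars K m j) < RingHom.ker (killVars K m (j+1)) := by
      refine lt_of_le_of_ne ?_ ?_
      · intro f hf
        rw [RingHom.mem_ker] at hf ⊢
        rw [← hcomp, AlgHom.comp_apply, hf, map_zero]
      · intro h
        have : (X ⟨j, by omega⟩ : MvPolynomial (Fin m) K) ∈ RingHom.ker (killVars K m j) := by
          rw [h, RingHom.mem_ker, killVars_X]; simp
        rw [RingHom.mem_ker, killVars_X] at this
        simp at this
    have := Ideal.height_add_one_le_of_lt_of_isPrime hlt
    push_cast
    exact le_trans (by gcongr) this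

lemma ker_killVars_le (K : Type*) [Field K] (m : ℕ) (Q : Ideal (MvPolynomial (Fin m) K))
    (hQ : ∀ i, X i ∈ Q) : RingHom.ker (killVars K m m) ≤ Q := by
  intro f hf
  rw [RingHom.mem_ker] at hf
  have hcomp : (Ideal.Quotient.mkₐ K Q).comp (killVars K m m) = Ideal.Quotient.mkₐ K Q := by
    apply MvPolynomial.algHom_ext
    intro i
    rw [AlgHom.comp_apply, killVars_X, if_pos i.2, map_zero]
    exact (Ideal.Quotient.eq_zero_iff_mem.mpr (hQ i)).symm
  have := DFunLike.congr_fun hcomp f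
  rw [AlgHom.comp_apply, hf, map_zero] at this
  exact Ideal.Quotient.eq_zero_iff_mem.mp this.symm

/-! ### Monomials and primes -/

lemma monomial_mem_prime {K : Type*} [Field K] {m : ℕ} (P : Ideal (MvPolynomial (Fin m) K))
    [hP : P.IsPrime] (e : Fin m →₀ ℕ) (c : K) (hc : c ≠ 0) :
    monomial e c ∈ P ↔ ∃ i, e i ≠ 0 ∧ X i ∈ P := by
  rw [monomial_eq, Ideal.unit_mul_mem_iff_mem P ((isUnit_iff_ne_zero.mpr hc).map C)]
  rw [Finsupp.prod, Ideal.IsPrime.prod_mem_iff]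
  constructor
  · rintro ⟨i, hi, h⟩
    exact ⟨i, by simpa using hi, hP.mem_of_pow_mem _ h⟩
  · rintro ⟨i, hi, h⟩
    exact ⟨i, by simpa using hi, Ideal.pow_mem_of_mem _ h _ (Nat.pos_of_ne_zero hi)⟩

lemma pp_ne {m : ℕ} (u : Fin m → ℤ) (i : Fin m) : pp u i ≠ 0 ↔ 0 < u i := by
  simp [pp]

lemma np_ne {m : ℕ} (u : Fin m → ℤ) (i : Fin m) : np u i ≠ 0 ↔ u i < 0 := by
  simp [np]

lemma Bpoly_zero {K : Type*} [Field K] {m : ℕ} {L : AddSubgroup (Fin m → ℤ)}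
    (ρ : AddChar L Kˣ) : Bpoly K ρ 0 = 0 := by
  have h1 : pp (0 : Fin m → ℤ) = 0 := by ext i; simp [pp]
  have h2 : np (0 : Fin m → ℤ) = 0 := by ext i; simp [np]
  simp [Bpoly, h1, h2]

lemma Bpoly_mem_latIdeal {K : Type*} [Field K] {m : ℕ} {L : AddSubgroup (Fin m → ℤ)}
    (ρ : AddChar L Kˣ) (u : L) : Bpoly K ρ u ∈ latIdeal K ρ :=
  Ideal.subset_span ⟨u, Set.mem_univ _, rfl⟩

lemma latIdeal_le {K : Type*} [Field K] {m : ℕ} {L : AddSubgroup (Fin m → ℤ)}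
    (ρ : AddChar L Kˣ) (P : Ideal (MvPolynomial (Fin m) K)) (h : ∀ u : L, Bpoly K ρ u ∈ P) :
    latIdeal K ρ ≤ P := by
  refine Ideal.span_le.mpr ?_
  rintro f ⟨u, -, rfl⟩
  exact h u

lemma Bpoly_mem_of {K : Type*} [Field K] {m : ℕ} {L : AddSubgroup (Fin m → ℤ)}
    (ρ : AddChar L Kˣ) (P : Ideal (MvPolynomial (Fin m) K)) [P.IsPrime] (u : L)
    (h1 : ∃ i, 0 < (u : Fin m → ℤ) i ∧ X i ∈ P) (h2 : ∃ i, (u : Fin m → ℤ) i < 0 ∧ X i ∈ P) :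
    Bpoly K ρ u ∈ P := by
  refine Ideal.sub_mem _ ?_ ?_
  · rw [monomial_mem_prime _ _ _ one_ne_zero]; simpa only [pp_ne] using h1
  · rw [monomial_mem_prime _ _ _ (Units.ne_zero _)]; simpa only [np_ne] using h2

lemma Bpoly_mem_iff {K : Type*} [Field K] {m : ℕ} {L : AddSubgroup (Fin m → ℤ)}
    (ρ : AddChar L Kˣ) (P : Ideal (MvPolynomial (Fin m) K)) [P.IsPrime] (u : L)
    (h : Bpoly K ρ u ∈ P) :
    (∃ i, 0 < (u : Fin m → ℤ) i ∧ X i ∈ P) ↔ (∃ i, (u : Fin m → ℤ) i < 0 ∧ X i ∈ P) := by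
  have h1 := monomial_mem_prime P (pp (u : Fin m → ℤ)) (1 : K) one_ne_zero
  have h2 := monomial_mem_prime P (np (u : Fin m → ℤ)) (ρ u : K) (Units.ne_zero _)
  simp only [pp_ne, np_ne] at h1 h2
  rw [← h1, ← h2]
  constructor
  · intro h3; have := Ideal.sub_mem _ h3 h; rwa [Bpoly, sub_sub_cancel] at this
  · intro h3; have := Ideal.add_mem _ h h3; rwa [Bpoly, sub_add_cancel] at this

/-! ### The torus case -/

lemma torus_aux {K : Type*} [Field K] {p : ℕ} [CharP K p] (hp : 0 < p) {m : ℕ}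
    {L : AddSubgroup (Fin m → ℤ)} (ρ : AddChar L Kˣ)
    (P : Ideal (MvPolynomial (Fin m) K)) [P.IsPrime] (hX : ∀ i, X i ∉ P) :
    ∃ H : AddSubgroup L, (∀ u : L, u ∈ H ↔ Bpoly K ρ u ∈ P) ∧
      ∀ (u : L) (N : ℕ), p ^ N • u ∈ H → u ∈ H := by
  haveI : Fact p.Prime := ⟨(CharP.char_is_prime_or_zero K p).resolve_right hp.ne'⟩
  let R := MvPolynomial (Fin m) K ⧸ P
  let F := FractionRing R
  let q : MvPolynomial (Fin m) K →ₐ[K] F :=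
    (IsScalarTower.toAlgHom K R F).comp (Ideal.Quotient.mkₐ K P)
  have hq : ∀ f, q f = 0 ↔ f ∈ P := by
    intro f
    have : q f = algebraMap R F (Ideal.Quotient.mk P f) := rfl
    rw [this, map_eq_zero_iff _ (IsFractionRing.injective R F), Ideal.Quotient.eq_zero_iff_mem]
  haveI : CharP F p := charP_of_injective_algebraMap (algebraMap K F).injective p
  have hy : ∀ i, q (X i) ≠ 0 := fun i h => hX i ((hq _).mp h)
  let χ : (Fin m → ℤ) → F := fun u => ∏ i, q (X i) ^ u i
  have hχ0 : χ 0 = 1 := by simp [χ]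
  have hχadd : ∀ u v, χ (u + v) = χ u * χ v := by
    intro u v
    simp only [χ, ← Finset.prod_mul_distrib]
    exact Finset.prod_congr rfl fun i _ => zpow_add₀ (hy i) _ _
  have hχne : ∀ u, χ u ≠ 0 := fun u =>
    Finset.prod_ne_zero_iff.mpr fun i _ => zpow_ne_zero _ (hy i)
  let r : L → F := fun u => algebraMap K F (ρ u : K)
  have hradd : ∀ u v, r (u + v) = r u * r v := by
    intro u v
    simp [r, AddChar.map_add_eq_mul]
  have hr0 : r 0 = 1 := by simp [r]
  have hmon : ∀ (e : Fin m →₀ ℕ) (c : K),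
      q (monomial e c) = algebraMap K F c * χ (fun i => (e i : ℤ)) := by
    intro e c
    rw [monomial_eq, map_mul, Finsupp.prod_fintype _ _ (by simp), map_prod]
    simp only [map_pow, χ, zpow_natCast]
    congr 1
  have key : ∀ u : L, Bpoly K ρ u ∈ P ↔ χ u = r u := by
    intro u
    rw [← hq, Bpoly, map_sub, hmon, hmon, sub_eq_zero, map_one, one_mul]
    have hsplit : (fun i => ((pp (u : Fin m → ℤ)) i : ℤ)) =
        (u : Fin m → ℤ) + fun i => ((np (u : Fin m → ℤ)) i : ℤ) := by
      funext i
      simp only [pp, np, Finsupp.equivFunOnFinite_symm_apply_apply, Pi.add_apply]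
      omega
    rw [hsplit, hχadd]
    exact mul_left_inj' (hχne _)
  refine ⟨{ carrier := {u | χ u = r u}
            add_mem' := ?_
            zero_mem' := ?_
            neg_mem' := ?_ }, ?_, ?_⟩
  · intro a b ha hb
    simp only [Set.mem_setOf_eq] at *
    rw [hradd, ← ha, ← hb, ← hχadd]; rfl
  · simp only [Set.mem_setOf_eq]
    rw [hr0, ← hχ0]; rfl
  · intro a ha
    simp only [Set.mem_setOf_eq] at *
    have h1 : χ (-a : L) * χ a = 1 := by
      rw [← hχadd, ← hχ0]; simp
    have h2 : r (-a) * r a = 1 := by rw [← hradd, ← hr0]; simp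
    rw [← ha, ← h1] at h2
    exact (mul_right_cancel₀ (hχne _) h2).symm
  · intro u; exact (key u).symm
  · intro u N hu
    change χ (p ^ N • u : L) = r (p ^ N • u) at hu
    change χ u = r u
    have h1 : ∀ k : ℕ, χ (k • u : L) = χ u ^ k := by
      intro k
      induction k with
      | zero => simp [hχ0]
      | succ k ih => rw [succ_nsmul, pow_succ, ← ih, ← hχadd]; rfl
    have h2 : ∀ k : ℕ, r (k • u : L) = r u ^ k := by
      intro k
      induction k with
      | zero => simp [hr0]
      | succ k ih => rw [succ_nsmul, pow_succ, ← ih, ← hradd]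
    rw [h1, h2] at hu
    haveI : ExpChar F p := ExpChar.prime (Fact.out)
    exact iterateFrobenius_inj F p N (by simpa [iterateFrobenius_def] using hu)

/-! ### Consequences of fullness -/

lemma full_coeffs {m n : ℕ} {A : Fin m → Fin n → ℤ} {hnm : n ≤ m} (hfull : IsFull hnm A) :
    ∃ lam : Fin m → Fin n → ℚ, (∀ (i : Fin m) t, n ≤ (i : ℕ) → 0 < lam i t) ∧
      (∀ s t, lam (Fin.castLE hnm s) t = if s = t then 1 else 0) ∧
      ∀ i, ratA A i = ∑ t, lam i t • ratA A (Fin.castLE hnm t) := by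
  classical
  have : ∀ i : Fin m, ∃ l : Fin n → ℚ, (∀ t, n ≤ (i : ℕ) → 0 < l t) ∧
      (∀ s, i = Fin.castLE hnm s → ∀ t, l t = if s = t then 1 else 0) ∧
      ratA A i = ∑ t, l t • ratA A (Fin.castLE hnm t) := by
    intro i
    by_cases hi : n ≤ (i : ℕ)
    · obtain ⟨l, h1, h2⟩ := hfull.2.2 i hi
      refine ⟨l, fun t _ => h1 t, ?_, h2⟩
      rintro s rfl
      have := s.2
      simp only [Fin.val_castLE] at hi
      omega
    · refine ⟨fun t => if (⟨i, by omega⟩ : Fin n) = t then 1 else 0, fun t h => absurd h hi, ?_, ?_⟩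
      · rintro s rfl t
        rfl
      · simp only [ite_smul, one_smul, zero_smul, Finset.sum_ite_eq, Finset.mem_univ, if_true]
        rfl
  choose lam h1 h2 h3 using this
  exact ⟨lam, fun i t => h1 i t, fun s t => h2 _ s rfl t, h3⟩

lemma full_zero {m n : ℕ} {L : AddSubgroup (Fin m → ℤ)} {A : Fin m → Fin n → ℤ}
    (hA : IsConfig L A) {hnm : n ≤ m} (hfull : IsFull hnm A) (w : Fin m → ℤ) (hw : w ∈ L)
    (h1 : ∀ i : Fin m, n ≤ (i : ℕ) → w i ≤ 0) (t : Fin n) (ht : w (Fin.castLE hnm t) ≤ 0) :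
    w = 0 := by
  classical
  obtain ⟨lam, hl1, hl2, hl3⟩ := full_coeffs hfull
  have hsum : ∑ i, w i • A i = 0 := (hA.1 w).mpr ⟨1, one_ne_zero, by simpa using hw⟩
  have hsumQ : ∑ i, (w i : ℚ) • ratA A i = 0 := by
    funext j
    have := congrFun hsum j
    simp only [Finset.sum_apply, Pi.smul_apply, smul_eq_mul, ratA, Pi.zero_apply] at this ⊢
    exact_mod_cast this
  have hco : ∀ s, ∑ i, (w i : ℚ) * lam i s = 0 := by
    refine Fintype.linearIndependent_iff.mp hfull.1 (fun s => ∑ i, (w i : ℚ) * lam i s) ?_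
    rw [← hsumQ]
    simp_rw [Finset.sum_smul, mul_smul]
    rw [Finset.sum_comm]
    refine Finset.sum_congr rfl fun i _ => ?_
    rw [← Finset.smul_sum, ← hl3]
  have hcases : ∀ i : Fin m, n ≤ (i : ℕ) ∨ ∃ s : Fin n, i = Fin.castLE hnm s := by
    intro i
    by_cases hi : n ≤ (i : ℕ)
    · exact Or.inl hi
    · exact Or.inr ⟨⟨i, by omega⟩, rfl⟩
  have hge : ∀ i : Fin m, n ≤ (i : ℕ) → w i = 0 := by
    have hterm : ∀ i ∈ Finset.univ, (w i : ℚ) * lam i t ≤ 0 := by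
      intro i _
      rcases hcases i with hi | ⟨s, rfl⟩
      · exact mul_nonpos_of_nonpos_of_nonneg (by exact_mod_cast h1 i hi) (hl1 i t hi).le
      · rw [hl2]
        split_ifs with h
        · subst h; simpa using ht
        · simp
    have := (Finset.sum_eq_zero_iff_of_nonpos hterm).mp (hco t)
    intro i hi
    have h := this i (Finset.mem_univ i)
    rcases mul_eq_zero.mp h with h | h
    · exact_mod_cast h
    · exact absurd h (hl1 i t hi).ne'
  funext i
  rcases hcases i with hi | ⟨s, rfl⟩
  · exact hge i hi
  · have h := hco s
    rw [Finset.sum_eq_single (Fin.castLE hnm s)] at h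
    · rw [hl2] at h; simpa using h
    · intro i _ hne
      rcases hcases i with hi | ⟨s', rfl⟩
      · simp [hge i hi]
      · rw [hl2, if_neg (fun h => hne (by rw [h])), mul_zero]
    · simp

lemma full_rel {m n : ℕ} {L : AddSubgroup (Fin m → ℤ)} {A : Fin m → Fin n → ℤ}
    (hA : IsConfig L A) {hnm : n ≤ m} (hfull : IsFull hnm A) (k : Fin m) (hk : n ≤ (k : ℕ)) :
    ∃ r ∈ L, (∀ i : Fin m, (i : ℕ) < n → r i < 0) ∧ 0 < r k ∧
      ∀ i : Fin m, n ≤ (i : ℕ) → i ≠ k → r i = 0 := by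
  classical
  obtain ⟨lam, hl1, hl2, hl3⟩ := full_coeffs hfull
  let D : ℕ := ∏ t, (lam k t).den
  have hD : 0 < D := Finset.prod_pos fun t _ => (lam k t).den_pos
  have hz : ∀ t, ∃ z : ℤ, (z : ℚ) = D * lam k t := by
    intro t
    obtain ⟨c, hc⟩ := Finset.dvd_prod_of_mem (fun t => (lam k t).den) (Finset.mem_univ t)
    refine ⟨c * (lam k t).num, ?_⟩
    have : (D : ℚ) = (lam k t).den * c := by exact_mod_cast hc
    rw [this]
    push_cast
    rw [mul_right_comm, Rat.den_mul_eq_num, mul_comm]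
  choose z hz using hz
  have hzpos : ∀ t, 0 < z t := by
    intro t
    have : (0 : ℚ) < z t := by
      rw [hz]; exact mul_pos (by exact_mod_cast hD) (hl1 k t hk)
    exact_mod_cast this
  let w : Fin m → ℤ := fun i => if h : (i : ℕ) < n then - z ⟨i, h⟩ else if i = k then D else 0
  have hwlt : ∀ i : Fin m, (i : ℕ) < n → w i < 0 := by
    intro i hi
    simp only [w, dif_pos hi]
    have := hzpos ⟨i, hi⟩
    omega
  have hwk : w k = D := by simp [w, not_lt.mpr hk]
  have hw0 : ∀ i : Fin m, n ≤ (i : ℕ) → i ≠ k → w i = 0 := by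
    intro i hi hik
    simp [w, not_lt.mpr hi, hik]
  have hwsum : ∑ i, w i • A i = 0 := by
    have hsplit : w = Pi.single k (D : ℤ) - ∑ t, Pi.single (Fin.castLE hnm t) (z t) := by
      funext i
      rw [Pi.sub_apply, Finset.sum_apply]
      by_cases hi : (i : ℕ) < n
      · have hik : i ≠ k := by rintro rfl; omega
        rw [Finset.sum_eq_single ⟨i, hi⟩]
        · have : Fin.castLE hnm ⟨i, hi⟩ = i := rfl
          simp [w, hi, hik, this]
        · intro b _ hb
          refine Pi.single_eq_of_ne ?_ _
          rintro rfl
          exact hb rfl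
        · simp
      · rw [Finset.sum_eq_zero]
        · simp [w, hi, Pi.single_apply]
        · intro b _
          refine Pi.single_eq_of_ne ?_ _
          rintro rfl
          exact hi b.2
    have hφ : ∀ u, Fintype.linearCombination ℤ A u = ∑ i, u i • A i :=
      fun u => Fintype.linearCombination_apply ℤ A u
    rw [← hφ, hsplit, map_sub, map_sum]
    simp only [Fintype.linearCombination_apply_single]
    funext j
    have h3 := congrFun (hl3 k) j
    simp only [ratA, Finset.sum_apply, Pi.smul_apply, smul_eq_mul] at h3
    have : ((D : ℤ) * A k j - ∑ t, (z t : ℚ) * A (Fin.castLE hnm t) j : ℚ) = 0 := by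
      rw [h3, Finset.mul_sum, sub_eq_zero]
      apply Finset.sum_congr rfl
      intro t _
      rw [hz]; push_cast; ring
    simp only [Pi.sub_apply, Finset.sum_apply, Pi.smul_apply, smul_eq_mul, Pi.zero_apply]
    exact_mod_cast this
  obtain ⟨d, hd0, hdL⟩ := (hA.1 w).mp hwsum
  have hdpos : 0 < |d| := abs_pos.mpr hd0
  refine ⟨|d| • w, ?_, ?_, ?_, ?_⟩
  · rcases abs_choice d with h | h
    · rw [h]; exact hdL
    · rw [h, neg_smul]; exact L.neg_mem hdL
  · intro i hi
    exact mul_neg_of_pos_of_neg hdpos (hwlt i hi)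
  · simp only [Pi.smul_apply, smul_eq_mul, hwk]
    exact mul_pos hdpos (by exact_mod_cast hD)
  · intro i hi hik
    simp [hw0 i hi hik]

lemma full_rel2 {m n : ℕ} {L : AddSubgroup (Fin m → ℤ)} {A : Fin m → Fin n → ℤ}
    (hA : IsConfig L A) {hnm : n ≤ m} (hfull : IsFull hnm A) (k : Fin m) (hk : n ≤ (k : ℕ)) :
    ∃ z ∈ L, (∀ i : Fin m, i < k → z i < 0) ∧ 0 < z k ∧ ∀ i : Fin m, k < i → z i = 0 := by
  classical
  have := full_rel hA hfull
  choose! r hrL hr1 hr2 hr3 using this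
  let S : Finset (Fin m) := Finset.univ.filter fun i => n ≤ (i : ℕ) ∧ i < k
  have hS : ∀ i, i ∈ S ↔ n ≤ (i : ℕ) ∧ i < k := by intro i; simp [S]
  let σ : Fin m → ℤ := ∑ i ∈ S, r i
  have hσ : ∀ t, σ t = ∑ i ∈ S, r i t := fun t => Finset.sum_apply _ _ _
  have hσ0 : ∀ t : Fin m, k ≤ t → σ t = 0 := by
    intro t ht
    rw [hσ]
    refine Finset.sum_eq_zero fun i hi => ?_
    obtain ⟨h1, h2⟩ := (hS i).mp hi
    exact hr3 i h1 t (le_trans hk ht) (by rintro rfl; exact absurd h2 (not_lt.mpr ht))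
  have hσ1 : ∀ t : Fin m, n ≤ (t : ℕ) → t < k → 0 < σ t := by
    intro t ht htk
    rw [hσ, Finset.sum_eq_single t]
    · exact hr2 t ht
    · intro i hi hne
      exact hr3 i ((hS i).mp hi).1 t ht (Ne.symm hne)
    · intro h; exact absurd ((hS t).mpr ⟨ht, htk⟩) h
  let M : ℤ := 1 + ∑ t, |σ t|
  have hM : ∀ t, |σ t| < M := by
    intro t
    have := Finset.single_le_sum (f := fun t => |σ t|) (fun t _ => abs_nonneg _) (Finset.mem_univ t)
    simp only [M]
    omega
  have hM0 : 0 < M := lt_of_le_of_lt (abs_nonneg _) (hM k)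
  refine ⟨M • r k - σ, L.sub_mem (L.zsmul_mem (hrL k hk) _)
    (AddSubgroup.sum_mem _ fun i hi => hrL i ((hS i).mp hi).1), ?_, ?_, ?_⟩
  · intro i hik
    simp only [Pi.sub_apply, Pi.smul_apply, smul_eq_mul]
    by_cases hi : n ≤ (i : ℕ)
    · rw [hr3 k hk i hi hik.ne]
      have := hσ1 i hi hik
      omega
    · have h1 := hr1 k hk i (by omega)
      have h2 := hM i
      have h3 := neg_abs_le (σ i)
      nlinarith
  · simp only [Pi.sub_apply, Pi.smul_apply, smul_eq_mul, hσ0 k le_rfl, sub_zero]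
    exact mul_pos hM0 (hr2 k hk)
  · intro i hik
    simp only [Pi.sub_apply, Pi.smul_apply, smul_eq_mul, hσ0 i hik.le, sub_zero]
    rw [hr3 k hk i (le_trans hk hik.le) hik.ne', mul_zero]

lemma exists_uv {m n p : ℕ} (hp : 1 < p) {L : AddSubgroup (Fin m → ℤ)} {A : Fin m → Fin n → ℤ}
    (hA : IsConfig L A) {hnm : n ≤ m} (hfull : IsFull hnm A) (k : Fin m) (hk : n ≤ (k : ℕ)) :
    ∃ (u v : L) (N : ℕ),
      (∀ i : Fin m, i < k → (u : Fin m → ℤ) i < 0) ∧ 0 < (u : Fin m → ℤ) k ∧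
      (∀ i : Fin m, k < i → (u : Fin m → ℤ) i = 0) ∧
      (∀ i : Fin m, k ≤ i → ((u : Fin m → ℤ) - (p ^ N) • (v : Fin m → ℤ)) i = 0) ∧
      ∀ w : L, (∀ i : Fin m, k < i → (w : Fin m → ℤ) i = 0) →
        ∃ c : ℤ, ∀ i : Fin m, k ≤ i → ((w : Fin m → ℤ) - c • (v : Fin m → ℤ)) i = 0 := by
  classical
  obtain ⟨z, hzL, hz1, hz2, hz3⟩ := full_rel2 hA hfull k hk
  let G : AddSubgroup ℤ :=
    { carrier := {a | ∃ w ∈ L, (∀ i : Fin m, k < i → w i = 0) ∧ w k = a}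
      add_mem' := by
        rintro a b ⟨w, h1, h2, h3⟩ ⟨w', h1', h2', h3'⟩
        exact ⟨w + w', L.add_mem h1 h1', fun i hi => by simp [h2 i hi, h2' i hi], by simp [h3, h3']⟩
      zero_mem' := ⟨0, L.zero_mem, by simp, rfl⟩
      neg_mem' := by
        rintro a ⟨w, h1, h2, h3⟩
        exact ⟨-w, L.neg_mem h1, fun i hi => by simp [h2 i hi], by simp [h3]⟩ }
  obtain ⟨g0, hg0⟩ := Int.subgroup_cyclic G
  have hmem : ∀ a, a ∈ G ↔ g0 ∣ a := by
    intro a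
    rw [hg0, AddSubgroup.mem_closure_singleton]
    simp only [smul_eq_mul]
    constructor
    · rintro ⟨c, rfl⟩; exact Dvd.intro_left c rfl
    · rintro ⟨c, rfl⟩; exact ⟨c, mul_comm _ _⟩
  have hzG : z k ∈ G := ⟨z, hzL, hz3, rfl⟩
  have hg0ne : g0 ≠ 0 := by
    rintro rfl
    have := zero_dvd_iff.mp ((hmem _).mp hzG)
    omega
  obtain ⟨v, hvL, hv1, hv2⟩ := (hmem |g0|).mpr (by simp)
  have hg : 0 < |g0| := abs_pos.mpr hg0ne
  obtain ⟨c, hc⟩ := (abs_dvd g0 _).mpr ((hmem _).mp hzG)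
  have hcpos : 0 < c := by
    rw [hc] at hz2
    exact pos_of_mul_pos_right hz2 hg.le
  let M : ℤ := 1 + ∑ i, |v i|
  have hM : ∀ t, |v t| < M := by
    intro t
    have := Finset.single_le_sum (f := fun t => |v t|) (fun t _ => abs_nonneg _) (Finset.mem_univ t)
    simp only [M]
    omega
  have hM0 : 0 < M := lt_of_le_of_lt (abs_nonneg _) (hM k)
  obtain ⟨N, hN⟩ := pow_unbounded_of_one_lt (c * (c * M)) (show (1 : ℤ) < p by exact_mod_cast hp)
  let q : ℤ := (p : ℤ) ^ N / c
  let s : ℤ := (p : ℤ) ^ N % c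
  have hqs : (p : ℤ) ^ N = c * q + s := (Int.mul_ediv_add_emod _ _).symm
  have hs0 : 0 ≤ s := Int.emod_nonneg _ hcpos.ne'
  have hsc : s < c := Int.emod_lt_of_pos _ hcpos
  have hq : c * M ≤ q := by
    rw [Int.le_ediv_iff_mul_le hcpos]
    linarith
  have hq0 : 0 < q := lt_of_lt_of_le (mul_pos hcpos hM0) hq
  have huk : (q • z + s • v) k = (p : ℤ) ^ N * v k := by
    simp only [Pi.add_apply, Pi.smul_apply, smul_eq_mul, hqs, hc, hv2]
    ring
  refine ⟨⟨q • z + s • v, L.add_mem (L.zsmul_mem hzL _) (L.zsmul_mem hvL _)⟩, ⟨v, hvL⟩, N,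
    ?_, ?_, ?_, ?_, ?_⟩
  · intro i hik
    simp only [Pi.add_apply, Pi.smul_apply, smul_eq_mul]
    have h1 := hz1 i hik
    have h2 : s * v i ≤ s * |v i| := mul_le_mul_of_nonneg_left (le_abs_self _) hs0
    have h3 : s * |v i| ≤ c * |v i| := mul_le_mul_of_nonneg_right hsc.le (abs_nonneg _)
    have h4 : c * |v i| < c * M := mul_lt_mul_of_pos_left (hM i) hcpos
    nlinarith
  · simp only
    rw [huk, hv2]
    positivity
  · intro i hik
    simp [hz3 i hik, hv1 i hik]
  · intro i hik
    rcases hik.eq_or_lt with rfl | h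
    · change (q • z + s • v) k - (p ^ N • v) k = 0
      rw [huk]
      simp
    · simp [hz3 i h, hv1 i h]
  · intro w hw
    obtain ⟨b, hb⟩ := (abs_dvd g0 _).mpr ((hmem _).mp ⟨w, w.2, hw, rfl⟩)
    refine ⟨b, fun i hik => ?_⟩
    rcases hik.eq_or_lt with rfl | h
    · simp [hb, hv2, mul_comm]
    · simp [hw i h, hv1 i h]


/-- The main geometric input: a prime containing the chosen binomials contains the ideal. -/
lemma prime_aux {K : Type*} [Field K] {p : ℕ} [CharP K p] (hp : 0 < p) {m n : ℕ}
    {L : AddSubgroup (Fin m → ℤ)} (ρ : AddChar L Kˣ)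
    {A : Fin m → Fin n → ℤ} (hA : IsConfig L A)
    {hnm : n ≤ m} (hfull : IsFull hnm A)
    (u v : Fin m → L) (N : Fin m → ℕ)
    (h1 : ∀ k : Fin m, n ≤ (k : ℕ) → ∀ i : Fin m, i < k → (u k : Fin m → ℤ) i < 0)
    (h2 : ∀ k : Fin m, n ≤ (k : ℕ) → 0 < (u k : Fin m → ℤ) k)
    (h3 : ∀ k : Fin m, n ≤ (k : ℕ) → ∀ i : Fin m, k < i → (u k : Fin m → ℤ) i = 0)
    (h4 : ∀ k : Fin m, n ≤ (k : ℕ) → ∀ i : Fin m, k ≤ i →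
      ((u k : Fin m → ℤ) - (p ^ (N k)) • (v k : Fin m → ℤ)) i = 0)
    (h5 : ∀ k : Fin m, n ≤ (k : ℕ) → ∀ w : L, (∀ i : Fin m, k < i → (w : Fin m → ℤ) i = 0) →
        ∃ c : ℤ, ∀ i : Fin m, k ≤ i → ((w : Fin m → ℤ) - c • (v k : Fin m → ℤ)) i = 0)
    (P : Ideal (MvPolynomial (Fin m) K)) [P.IsPrime]
    (hP : ∀ k : Fin m, n ≤ (k : ℕ) → Bpoly K ρ (u k) ∈ P) :
    latIdeal K ρ ≤ P := by
  classical
  apply latIdeal_le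
  by_cases hX : ∀ i, X i ∉ P
  · obtain ⟨H, hH, hHp⟩ := torus_aux hp ρ P hX
    have key : ∀ j : ℕ, n ≤ j → j ≤ m → ∀ w : L,
        (∀ i : Fin m, j ≤ (i : ℕ) → (w : Fin m → ℤ) i = 0) → w ∈ H := by
      intro j hj
      induction j, hj using Nat.le_induction with
      | base =>
        intro _ w hw
        have : w = 0 := by
          apply Subtype.ext
          rcases Nat.eq_zero_or_pos n with hn | hn
          · funext i
            exact hw i (by omega)
          · by_cases ht : (w : Fin m → ℤ) (Fin.castLE hnm ⟨0, hn⟩) ≤ 0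
            · exact full_zero hA hfull w w.2 (fun i hi => (hw i hi).le) ⟨0, hn⟩ ht
            · have := full_zero hA hfull (-w : Fin m → ℤ) (L.neg_mem w.2)
                (fun i hi => by simp [hw i hi]) ⟨0, hn⟩ (by simp only [Pi.neg_apply]; omega)
              simpa using this
        rw [this]; exact H.zero_mem
      | succ j hj ih =>
        intro hjm w hw
        have ih := ih (by omega)
        let k : Fin m := ⟨j, by omega⟩
        have hk : n ≤ (k : ℕ) := hj
        have hv : v k ∈ H := by
          apply hHp _ (N k)
          have hd : u k - p ^ (N k) • v k ∈ H := ih _ fun i hi => h4 k hk i hi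
          have := H.sub_mem ((hH _).mpr (hP k hk)) hd
          rwa [sub_sub_cancel] at this
        obtain ⟨c, hc⟩ := h5 k hk w fun i hi => hw i hi
        have hd : w - c • v k ∈ H := ih _ fun i hi => hc i hi
        have := H.add_mem hd (H.zsmul_mem hv c)
        rwa [sub_add_cancel] at this
    intro w
    rw [← hH]
    exact key m hnm le_rfl w fun i hi => absurd i.2 (not_lt.mpr hi)
  · push Not at hX
    obtain ⟨i0, hi0⟩ := hX
    have hstep : ∀ k : Fin m, n ≤ (k : ℕ) → (X k ∈ P ↔ ∃ i, i < k ∧ X i ∈ P) := by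
      intro k hk
      have hiff := Bpoly_mem_iff ρ P (u k) (hP k hk)
      have ha : (∃ i, 0 < (u k : Fin m → ℤ) i ∧ X i ∈ P) ↔ X k ∈ P := by
        constructor
        · rintro ⟨i, hi, hx⟩
          rcases lt_trichotomy i k with h | h | h
          · have := h1 k hk i h; omega
          · rwa [← h]
          · have := h3 k hk i h; omega
        · intro hx; exact ⟨k, h2 k hk, hx⟩
      have hb : (∃ i, (u k : Fin m → ℤ) i < 0 ∧ X i ∈ P) ↔ ∃ i, i < k ∧ X i ∈ P := by
        constructor
        · rintro ⟨i, hi, hx⟩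
          rcases lt_trichotomy i k with h | h | h
          · exact ⟨i, h, hx⟩
          · subst h; have := h2 i hk; omega
          · have := h3 k hk i h; omega
        · rintro ⟨i, hi, hx⟩; exact ⟨i, h1 k hk i hi, hx⟩
      rw [← ha, ← hb]; exact hiff
    have hdown : ∀ j : ℕ, ∀ hj : j < m, X ⟨j, hj⟩ ∈ P → ∃ t : Fin n, X (Fin.castLE hnm t) ∈ P := by
      intro j
      induction j using Nat.strong_induction_on with
      | _ j ih =>
        intro hj hx
        by_cases hjn : j < n
        · exact ⟨⟨j, hjn⟩, hx⟩
        · obtain ⟨i, hi, hxi⟩ := (hstep ⟨j, hj⟩ (not_lt.mp hjn)).mp hx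
          exact ih i hi i.2 hxi
    obtain ⟨t, ht⟩ := hdown i0 i0.2 hi0
    have hup : ∀ k : Fin m, n ≤ (k : ℕ) → X k ∈ P := by
      intro k hk
      refine (hstep k hk).mpr ⟨_, ?_, ht⟩
      have := t.2
      rw [Fin.lt_def, Fin.val_castLE]
      omega
    have hposX : ∀ w : Fin m → ℤ, w ∈ L → w ≠ 0 → ∃ i, 0 < w i ∧ X i ∈ P := by
      intro w hw hw0
      by_contra hcon
      push Not at hcon
      refine hw0 (full_zero hA hfull w hw (fun i hi => ?_) t ?_)
      · by_contra h
        exact hcon i (not_le.mp h) (hup i hi)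
      · by_contra h
        exact hcon _ (not_le.mp h) ht
    intro w
    by_cases hw : w = 0
    · rw [hw, Bpoly_zero]; exact P.zero_mem
    · have hw' : (w : Fin m → ℤ) ≠ 0 := fun h => hw (Subtype.ext h)
      refine Bpoly_mem_of ρ P w (hposX w w.2 hw') ?_
      obtain ⟨i, hi, hx⟩ := hposX (-w : Fin m → ℤ) (L.neg_mem w.2) (neg_ne_zero.mpr hw')
      exact ⟨i, by simpa using hi, hx⟩

/-- Theorem 4.4, positive characteristic: if the configuration associated to
`L` is full, then `I_{L,ρ}` is a set-theoretic complete intersection: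
`ara I_{L,ρ} = rank L = m - n`, and `rad I_{L,ρ}` is the radical of an ideal generated by
`m - n` binomials of `I_{L,ρ}`. -/
theorem statement11 {K : Type*} [Field K] {p : ℕ} [CharP K p] (hp : 0 < p) {m n : ℕ}
    (L : AddSubgroup (Fin m → ℤ)) (ρ : AddChar L Kˣ)
    (hL : L ≠ ⊥) (hpos : IsPositive L)
    (A : Fin m → Fin n → ℤ) (hA : IsConfig L A)
    (hnm : n ≤ m) (hfull : IsFull hnm A) :
    ara (latIdeal K ρ) = m - n ∧ latRank L = m - n ∧
      ∃ u : Fin (m - n) → L,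
        (Ideal.span (Set.range fun i => Bpoly K ρ (u i))).radical =
          (latIdeal K ρ).radical := by
  classical
  have hp1 : 1 < p := ((CharP.char_is_prime_or_zero K p).resolve_right hp.ne').one_lt
  have hex : ∀ k : Fin m, n ≤ (k : ℕ) → _ := exists_uv hp1 hA hfull
  choose! u v N h1 h2 h3 h4 h5 using hex
  let U : Fin (m - n) → L := fun j => u ⟨n + j, by omega⟩
  have hU : ∀ k : Fin m, n ≤ (k : ℕ) → ∃ j, U j = u k := by
    intro k hk
    refine ⟨⟨k - n, by omega⟩, ?_⟩
    simp only [U]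
    congr 1
    exact Fin.ext (by simp only; omega)
  have hrad : (Ideal.span (Set.range fun i => Bpoly K ρ (U i))).radical =
      (latIdeal K ρ).radical := by
    apply le_antisymm
    · apply Ideal.radical_mono
      rw [Ideal.span_le]
      rintro _ ⟨j, rfl⟩
      exact Bpoly_mem_latIdeal ρ _
    · rw [Ideal.radical_le_radical_iff, Ideal.radical_eq_sInf]
      refine le_sInf ?_
      rintro P ⟨hPs, hPp⟩
      refine prime_aux hp ρ hA hfull u v N h1 h2 h3 h4 h5 P fun k hk => ?_
      obtain ⟨j, hj⟩ := hU k hk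
      rw [← hj]
      exact hPs (Ideal.subset_span ⟨j, rfl⟩)
  refine ⟨?_, rank_aux L A hA, U, hrad⟩
  apply le_antisymm
  · exact Nat.sInf_le ⟨fun i => Bpoly K ρ (U i), fun i => Bpoly_mem_latIdeal ρ _, hrad⟩
  · refine le_csInf ⟨m - n, fun i => Bpoly K ρ (U i), fun i => Bpoly_mem_latIdeal ρ _, hrad⟩ ?_
    rintro s ⟨f, hfI, hfrad⟩
    have hm : 0 < m := by
      rcases Nat.eq_zero_or_pos m with h | h
      · subst h
        exact absurd (Subsingleton.elim _ _) hL
      · exact h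
    have hn : 0 < n := by
      rcases Nat.eq_zero_or_pos n with h | h
      · exfalso
        have hk : n ≤ ((⟨0, hm⟩ : Fin m) : ℕ) := by simp [h]
        have hz := hpos (u ⟨0, hm⟩) (u ⟨0, hm⟩).2 (fun i => by
          rcases Nat.eq_zero_or_pos (i : ℕ) with h0 | h0
          · have : i = ⟨0, hm⟩ := Fin.ext h0
            rw [this]; exact (h2 _ hk).le
          · exact (h3 _ hk i h0).ge)
        have := h2 _ hk
        rw [hz] at this
        exact lt_irrefl _ this
      · exact h
    let m0 : Ideal (MvPolynomial (Fin m) K) := RingHom.ker (killVars K m m)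
    haveI : m0.IsPrime := RingHom.ker_isPrime _
    have hXm0 : ∀ i, X i ∈ m0 := fun i => by
      rw [RingHom.mem_ker, killVars_X, if_pos i.2]
    have hI : latIdeal K ρ ≤ m0 := by
      apply latIdeal_le
      have hposX : ∀ w : Fin m → ℤ, w ∈ L → w ≠ 0 → ∃ i, w i < 0 := by
        intro w hw hw0
        by_contra hcon
        push Not at hcon
        exact hw0 (hpos w hw hcon)
      intro w
      by_cases hw : w = 0
      · rw [hw, Bpoly_zero]; exact m0.zero_mem
      · have hw' : (w : Fin m → ℤ) ≠ 0 := fun h => hw (Subtype.ext h)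
        refine Bpoly_mem_of ρ m0 w ?_ ?_
        · obtain ⟨i, hi⟩ := hposX (-w : Fin m → ℤ) (L.neg_mem w.2) (neg_ne_zero.mpr hw')
          exact ⟨i, by simpa using hi, hXm0 i⟩
        · obtain ⟨i, hi⟩ := hposX w w.2 hw'
          exact ⟨i, hi, hXm0 i⟩
    let S : Finset (MvPolynomial (Fin m) K) :=
      Finset.univ.image f ∪ Finset.univ.image fun t : Fin n => X (Fin.castLE hnm t)
    have hScard : S.card ≤ s + n := by
      refine (Finset.card_union_le _ _).trans (add_le_add ?_ ?_)
      · simpa using Finset.card_image_le (s := Finset.univ) (f := f)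
      · simpa using Finset.card_image_le (s := Finset.univ)
          (f := fun t : Fin n => (X (Fin.castLE hnm t) : MvPolynomial (Fin m) K))
    have hmin : m0 ∈ (Ideal.span (S : Set (MvPolynomial (Fin m) K))).minimalPrimes := by
      refine ⟨⟨inferInstance, ?_⟩, ?_⟩
      · rw [Ideal.span_le]
        intro g hg
        simp only [S, Finset.coe_union, Finset.coe_image, Finset.coe_univ, Set.image_univ,
          Set.mem_union, Set.mem_range] at hg
        rcases hg with ⟨i, rfl⟩ | ⟨t, rfl⟩
        · exact hI (hfI i)
        · exact hXm0 _
      · rintro Q ⟨hQp, hQ⟩ -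
        refine ker_killVars_le K m Q ?_
        have hfQ : Ideal.span (Set.range f) ≤ Q := by
          rw [Ideal.span_le]
          rintro _ ⟨i, rfl⟩
          exact hQ (Ideal.subset_span (by simp [S]))
        have hIQ : latIdeal K ρ ≤ Q := by
          refine Ideal.le_radical.trans ?_
          rw [← hfrad]
          exact hQp.radical_le_iff.mpr hfQ
        have hXt : ∀ t : Fin n, X (Fin.castLE hnm t) ∈ Q := fun t =>
          hQ (Ideal.subset_span (by simp [S]))
        intro k
        by_cases hk : n ≤ (k : ℕ)
        · obtain ⟨i, hi, hx⟩ := (Bpoly_mem_iff ρ Q (u k) (hIQ (Bpoly_mem_latIdeal ρ _))).mpr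
            ⟨Fin.castLE hnm ⟨0, hn⟩, h1 k hk _ (by rw [Fin.lt_def]; simp only [Fin.val_castLE]; omega),
              hXt _⟩
          rcases lt_trichotomy i k with h | h | h
          · have := h1 k hk i h; omega
          · rwa [← h]
          · have := h3 k hk i h; omega
        · exact hXt ⟨k, by omega⟩
    have hht := Ideal.height_le_card_of_mem_minimalPrimes_span_finset hmin
    have hge := (height_aux K m m le_rfl).trans hht
    have : m ≤ S.card := by exact_mod_cast hge
    omega

end LatticePaper
end

section
/- Let K be a field of characteristic zero and let I_A ⊂ K[x₁,…,x₁₀] be the toric ideal of the (3,3)-Veronese configuration A = {(a₁,a₂,a₃) ∈ ℕ³ : a₁+a₂+a₃ = 3}. Then the binomial arithmetical rank of I_A equals 11; in particular there exist 11 binomials in I_A whose radical ideal equals rad(I_A), and no set of 10 or fewer binomials in I_A generates rad(I_A) up to radical. -/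
open MvPolynomial

namespace LatticePaper

theorem pp_np_decomp {m : ℕ} (a b : Fin m →₀ ℕ) (u : Fin m → ℤ)
    (hu : ∀ i, u i = (a i : ℤ) - b i) :
    ∃ g : Fin m →₀ ℕ, a = g + pp u ∧ b = g + np u := by
  refine ⟨a ⊓ b, ?_, ?_⟩
  · ext i
    have := hu i
    simp only [pp, Finsupp.add_apply, Finsupp.inf_apply, Finsupp.equivFunOnFinite_symm_apply_apply]
    omega
  · ext i
    have := hu i
    simp only [np, Finsupp.add_apply, Finsupp.inf_apply, Finsupp.equivFunOnFinite_symm_apply_apply]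
    omega

theorem mem_toric {m n : ℕ} (K : Type*) [Field K] (A : Fin m → Fin n → ℤ) (a b : Fin m →₀ ℕ)
    (h : ∀ j, ∑ i, (a i : ℤ) * A i j = ∑ i, (b i : ℤ) * A i j) :
    monomial a (1 : K) - monomial b 1 ∈ toricIdeal K A := by
  obtain ⟨g, ha, hb⟩ := pp_np_decomp a b (fun i => (a i : ℤ) - b i) (fun i => rfl)
  have e : monomial a (1 : K) - monomial b 1 = monomial g 1 *
      (monomial (pp (fun i => (a i : ℤ) - b i)) (1 : K)
        - monomial (np (fun i => (a i : ℤ) - b i)) 1) := by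
    rw [mul_sub, monomial_mul, monomial_mul, ← ha, ← hb, one_mul]
  rw [e]
  apply Ideal.mul_mem_left
  apply Ideal.subset_span
  refine ⟨_, ?_, rfl⟩
  ext j
  simp only [Finset.sum_apply, Pi.smul_apply, smul_eq_mul, sub_mul, Finset.sum_sub_distrib,
    h j, sub_self, Pi.zero_apply]

/-- The point `x` satisfies the binomial of `u`. -/
def VV {m : ℕ} {F : Type*} [Field F] (x : Fin m → F) (u : Fin m → ℤ) : Prop :=
  ∏ i, x i ^ (u i).toNat = ∏ i, x i ^ (-u i).toNat

theorem aeval_mono {m : ℕ} {K F : Type*} [Field K] [CommRing F] [Algebra K F] (x : Fin m → F)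
    (a : Fin m →₀ ℕ) : aeval x (monomial a (1 : K)) = ∏ i, x i ^ (a i) := by
  rw [aeval_monomial, map_one, one_mul, Finsupp.prod_fintype]
  simp

theorem aeval_B {m : ℕ} {K F : Type*} [Field K] [Field F] [Algebra K F] (x : Fin m → F)
    (u : Fin m → ℤ) :
    aeval x (monomial (pp u) (1 : K) - monomial (np u) 1) = 0 ↔ VV x u := by
  rw [map_sub, aeval_mono, aeval_mono, sub_eq_zero]
  simp [VV, pp, np]

theorem veroneseA_nonneg : ∀ i j, 0 ≤ veroneseA i j := by decide

theorem veroneseA_sum : ∀ i, veroneseA i 0 + veroneseA i 1 + veroneseA i 2 = 3 := by decide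

/-- A parametrized point kills the toric ideal. -/
theorem param_kills {K F : Type*} [Field K] [Field F] [Algebra K F] (x : Fin 10 → F)
    (s : F) (t : Fin 3 → F)
    (hx : ∀ i, x i = s * ∏ j, t j ^ (veroneseA i j).toNat)
    (f : MvPolynomial (Fin 10) K) (hf : f ∈ toricIdeal K veroneseA) : aeval x f = 0 := by
  have key : toricIdeal K veroneseA ≤ RingHom.ker (aeval x : MvPolynomial (Fin 10) K →ₐ[K] F) := by
    apply Ideal.span_le.2
    rintro _ ⟨u, hu, rfl⟩
    rw [SetLike.mem_coe, RingHom.mem_ker, aeval_B]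
    have hj : ∀ j, ∑ i, (u i).toNat * (veroneseA i j).toNat
        = ∑ i, (-u i).toNat * (veroneseA i j).toNat := by
      intro j
      have h1 := congrFun hu j
      simp only [Finset.sum_apply, Pi.smul_apply, smul_eq_mul, Pi.zero_apply] at h1
      zify
      rw [← sub_eq_zero, ← Finset.sum_sub_distrib, ← h1]
      apply Finset.sum_congr rfl
      intro i _
      rw [← sub_mul, Int.toNat_of_nonneg (veroneseA_nonneg i j)]
      congr 1
      omega
    have hs : ∑ i, (u i).toNat = ∑ i, (-u i).toNat := by
      have h3 : ∀ i, (veroneseA i 0).toNat + (veroneseA i 1).toNat + (veroneseA i 2).toNat = 3 := by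
        decide
      have e : ∀ v : Fin 10 → ℕ, 3 * ∑ i, v i = ∑ i, v i * (veroneseA i 0).toNat
          + ∑ i, v i * (veroneseA i 1).toNat + ∑ i, v i * (veroneseA i 2).toNat := by
        intro v
        rw [← Finset.sum_add_distrib, ← Finset.sum_add_distrib, Finset.mul_sum]
        apply Finset.sum_congr rfl
        intro i _
        rw [← mul_add, ← mul_add, h3, mul_comm]
      have e1 := e (fun i => (u i).toNat)
      have e2 := e (fun i => (-u i).toNat)
      have := hj 0
      have := hj 1
      have := hj 2
      omega
    have expand : ∀ v : Fin 10 → ℕ, ∏ i, x i ^ v i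
        = s ^ (∑ i, v i) * ∏ j, t j ^ (∑ i, v i * (veroneseA i j).toNat) := by
      intro v
      rw [← Finset.prod_pow_eq_pow_sum]
      simp_rw [← Finset.prod_pow_eq_pow_sum]
      rw [Finset.prod_comm, ← Finset.prod_mul_distrib]
      apply Finset.prod_congr rfl
      intro i _
      rw [hx i, mul_pow, ← Finset.prod_pow]
      congr 1
      apply Finset.prod_congr rfl
      intro j _
      rw [← pow_mul, mul_comm]
    unfold VV
    rw [expand, expand, hs]
    congr 1
    apply Finset.prod_congr rfl
    intro j _
    rw [hj]
  exact key hf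

theorem binom_form {K : Type*} [Field K] [CharZero K] (f : MvPolynomial (Fin 10) K)
    (hf : f ∈ toricIdeal K veroneseA) (hb : IsBinomial f) :
    ∃ u : Fin 10 → ℤ, (∀ j, ∑ i, u i * veroneseA i j = 0) ∧
      (monomial (pp u) (1 : K) - monomial (np u) 1) ∣ f := by
  obtain ⟨a, b, c, d, rfl⟩ := hb
  have h1 := param_kills (K := K) (F := K) (fun _ => 1) 1 (fun _ => 1) (by simp) _ hf
  have hm : ∀ (x : Fin 10 → K) (a : Fin 10 →₀ ℕ) (c : K),
      aeval x (monomial a c) = c * ∏ i, x i ^ a i := by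
    intro x a c
    rw [aeval_monomial, Finsupp.prod_fintype]
    · rfl
    · simp
  rw [map_add, hm, hm] at h1
  simp only [one_pow, Finset.prod_const_one, mul_one] at h1
  have hd : d = -c := by linear_combination h1
  subst hd
  by_cases hc : c = 0
  · refine ⟨0, by simp, ?_⟩
    subst hc
    simp
  · have hdeg : ∀ j, ∑ i, a i * (veroneseA i j).toNat = ∑ i, b i * (veroneseA i j).toNat := by
      intro j
      have h2 := param_kills (K := K) (F := K) (fun i => 2 ^ (veroneseA i j).toNat) 1
        (fun k => if k = j then 2 else 1)
        (by
          intro i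
          rw [one_mul, Finset.prod_eq_single j]
          · simp
          · intro k _ hk; simp [hk]
          · simp) _ hf
      rw [map_add, hm, hm] at h2
      simp_rw [← pow_mul] at h2
      rw [Finset.prod_pow_eq_pow_sum, Finset.prod_pow_eq_pow_sum] at h2
      have h3 : (2 : K) ^ (∑ i, (veroneseA i j).toNat * a i)
          = 2 ^ (∑ i, (veroneseA i j).toNat * b i) := by
        apply mul_left_cancel₀ hc
        linear_combination h2
      have h4 : (2 : ℕ) ^ (∑ i, (veroneseA i j).toNat * a i)
          = 2 ^ (∑ i, (veroneseA i j).toNat * b i) := by exact_mod_cast h3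
      have h5 := Nat.pow_right_injective (le_refl 2) h4
      simpa only [mul_comm] using h5
    obtain ⟨g, ha, hb⟩ := pp_np_decomp a b (fun i => (a i : ℤ) - b i) (fun i => rfl)
    refine ⟨fun i => (a i : ℤ) - b i, ?_, monomial g c, ?_⟩
    · intro j
      have := hdeg j
      zify at this
      simp_rw [Int.toNat_of_nonneg (veroneseA_nonneg _ _)] at this
      simp only [sub_mul, Finset.sum_sub_distrib, this, sub_self]
    · rw [sub_mul, monomial_mul, monomial_mul, one_mul, add_comm _ g, add_comm _ g, ← ha, ← hb,
        map_neg, sub_eq_add_neg]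

/-- Values of points supported on `T` with value one. -/
theorem prod_ind {F : Type*} [Field F] (T : Finset (Fin 10)) (v : Fin 10 → ℕ) :
    ∏ i, (if i ∈ T then (1 : F) else 0) ^ v i = if ∀ i, i ∉ T → v i = 0 then 1 else 0 := by
  split_ifs with h
  · apply Finset.prod_eq_one
    intro i _
    by_cases hi : i ∈ T
    · simp [hi]
    · simp [h i hi]
  · push Not at h
    obtain ⟨i, hi, hv⟩ := h
    apply Finset.prod_eq_zero (Finset.mem_univ i)
    simp [hi, hv]

theorem not_VV_ind {F : Type*} [Field F] (T : Finset (Fin 10)) (u : Fin 10 → ℤ)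
    (h : ¬ VV (fun i => if i ∈ T then (1 : F) else 0) u) :
    ((∀ i, i ∉ T → u i ≤ 0) ∧ ∃ i, i ∉ T ∧ u i < 0) ∨
    ((∀ i, i ∉ T → 0 ≤ u i) ∧ ∃ i, i ∉ T ∧ 0 < u i) := by
  unfold VV at h
  rw [prod_ind, prod_ind] at h
  simp only [Int.toNat_eq_zero, Left.neg_nonpos_iff] at h
  by_cases h1 : ∀ i, i ∉ T → u i ≤ 0
  · by_cases h2 : ∀ i, i ∉ T → 0 ≤ u i
    · rw [if_pos h1, if_pos h2] at h
      exact absurd rfl h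
    · push Not at h2
      exact Or.inl ⟨h1, h2⟩
  · by_cases h2 : ∀ i, i ∉ T → 0 ≤ u i
    · push Not at h1
      exact Or.inr ⟨h2, h1⟩
    · rw [if_neg h1, if_neg h2] at h
      exact absurd rfl h

theorem supp_of_nonpos (u : Fin 10 → ℤ) (j : Fin 3) (hu : ∑ i, u i * veroneseA i j = 0)
    (h : ∀ i, veroneseA i j ≠ 0 → u i ≤ 0) : ∀ i, veroneseA i j ≠ 0 → u i = 0 := by
  have h0 := (Finset.sum_eq_zero_iff_of_nonpos (s := Finset.univ)
    (f := fun i => u i * veroneseA i j) (by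
      intro i _
      by_cases hi : veroneseA i j = 0
      · simp [hi]
      · exact mul_nonpos_of_nonpos_of_nonneg (h i hi) (veroneseA_nonneg i j))).1 hu
  intro i hi
  have := h0 i (Finset.mem_univ i)
  simpa [hi] using this

theorem supp_of_nonneg (u : Fin 10 → ℤ) (j : Fin 3) (hu : ∑ i, u i * veroneseA i j = 0)
    (h : ∀ i, veroneseA i j ≠ 0 → 0 ≤ u i) : ∀ i, veroneseA i j ≠ 0 → u i = 0 := by
  intro i hi
  have := supp_of_nonpos (fun i => -u i) j (by simp [hu]) (fun i hi => by simpa using h i hi) i hi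
  simpa using this

/-- On a point supported on a facet, binomials not supported on it vanish. -/
theorem VV_of_not_supp {F : Type*} [Field F] (x : Fin 10 → F) (u : Fin 10 → ℤ) (j : Fin 3)
    (hu : ∑ i, u i * veroneseA i j = 0)
    (hx : ∀ i, veroneseA i j ≠ 0 → x i = 0)
    (h : ¬ ∀ i, veroneseA i j ≠ 0 → u i = 0) : VV x u := by
  have h1 : ∃ i, veroneseA i j ≠ 0 ∧ 0 < u i := by
    by_contra hc
    push Not at hc
    exact h (supp_of_nonpos u j hu hc)
  have h2 : ∃ i, veroneseA i j ≠ 0 ∧ u i < 0 := by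
    by_contra hc
    push Not at hc
    exact h (supp_of_nonneg u j hu hc)
  obtain ⟨i, hi, hi'⟩ := h1
  obtain ⟨k, hk, hk'⟩ := h2
  unfold VV
  rw [Finset.prod_eq_zero (Finset.mem_univ i), Finset.prod_eq_zero (Finset.mem_univ k)]
  · rw [hx k hk, zero_pow]; omega
  · rw [hx i hi, zero_pow]; omega

/-- The key point criterion. -/
def Crit {F : Type*} [Field F] {s : ℕ} (u : Fin s → Fin 10 → ℤ) : Prop :=
  ∀ x : Fin 10 → F, (∀ i, VV x (u i)) → ∀ a b c d : Fin 10,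
    (∀ j, veroneseA a j + veroneseA b j = veroneseA c j + veroneseA d j) → x a * x b = x c * x d

theorem exists_root {F : Type*} [Field F] [CharZero F] [IsAlgClosed F] (b : ℕ) (hb : 2 ≤ b) :
    ∃ z : F, z ≠ 1 ∧ z ^ b = 1 := by
  have : NeZero (b : F) := ⟨by exact_mod_cast (by omega : b ≠ 0)⟩
  obtain ⟨z, hz⟩ := HasEnoughRootsOfUnity.exists_primitiveRoot F b
  exact ⟨z, hz.ne_one (by omega), hz.pow_eq_one⟩

/-- The point which is one on the facet `j` except for the value `ζ` at `z`. -/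
def zpt {F : Type*} [Field F] (j : Fin 3) (z : Fin 10) (ζ : F) : Fin 10 → F :=
  fun i => if i = z then ζ else if veroneseA i j = 0 then 1 else 0

theorem VV_zpt {F : Type*} [Field F] (j : Fin 3) (z : Fin 10) (hz : veroneseA z j = 0) (ζ : F)
    (u : Fin 10 → ℤ) (hu : ∑ i, u i * veroneseA i j = 0)
    (h : (∀ i, veroneseA i j ≠ 0 → u i = 0) → ζ ^ (u z).natAbs = 1) : VV (zpt j z ζ) u := by
  by_cases hs : ∀ i, veroneseA i j ≠ 0 → u i = 0
  · have h := h hs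
    unfold VV
    have e : ∀ v : Fin 10 → ℕ, (∀ i, veroneseA i j ≠ 0 → v i = 0) →
        ∏ i, zpt j z ζ i ^ v i = ζ ^ v z := by
      intro v hv
      rw [Finset.prod_eq_single z]
      · simp [zpt]
      · intro i _ hi
        by_cases h0 : veroneseA i j = 0
        · simp [zpt, hi, h0]
        · simp [hv i h0]
      · simp
    rw [e _ (fun i hi => by simp [hs i hi]), e _ (fun i hi => by simp [hs i hi])]
    rcases le_total 0 (u z) with h0 | h0
    · rw [show (u z).toNat = (u z).natAbs by omega, show (-u z).toNat = 0 by omega, h, pow_zero]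
    · rw [show (-u z).toNat = (u z).natAbs by omega, show (u z).toNat = 0 by omega, h, pow_zero]
  · apply VV_of_not_supp _ _ j hu _ hs
    intro i hi
    have : i ≠ z := by rintro rfl; exact hi hz
    simp [zpt, this, hi]

/-- The indices of nonzero binomials supported on the facet `j`. -/
def edgeSet {s : ℕ} (u : Fin s → Fin 10 → ℤ) (j : Fin 3) : Finset (Fin s) :=
  Finset.univ.filter fun i => u i ≠ 0 ∧ ∀ k, veroneseA k j ≠ 0 → u i k = 0

theorem exists_cover {F : Type*} [Field F] {s : ℕ} (u : Fin s → Fin 10 → ℤ)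
    (hu : ∀ i j, ∑ k, u i k * veroneseA k j = 0)
    (hcrit : Crit (F := F) u) (j : Fin 3) (T : Finset (Fin 10)) (hT : ∀ i ∈ T, veroneseA i j = 0)
    (a b c d : Fin 10)
    (hq : ∀ j, veroneseA a j + veroneseA b j = veroneseA c j + veroneseA d j)
    (ha : a ∈ T) (hb : b ∈ T) (hc : c ∉ T) :
    ∃ i ∈ edgeSet u j, ((∀ k, k ∉ T → u i k ≤ 0) ∧ ∃ k, k ∉ T ∧ u i k < 0) ∨
      ((∀ k, k ∉ T → 0 ≤ u i k) ∧ ∃ k, k ∉ T ∧ 0 < u i k) := by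
  by_contra hcon
  have h := hcrit (fun i => if i ∈ T then (1 : F) else 0) (by
    intro i
    by_contra hV
    have h2 := not_VV_ind T (u i) hV
    refine hcon ⟨i, ?_, h2⟩
    have hnz : u i ≠ 0 := by
      intro h0
      rcases h2 with ⟨-, k, -, hk⟩ | ⟨-, k, -, hk⟩ <;> simp [h0] at hk
    simp only [edgeSet, Finset.mem_filter, Finset.mem_univ, true_and]
    refine ⟨hnz, ?_⟩
    have hT' : ∀ k, veroneseA k j ≠ 0 → k ∉ T := fun k hk hkT => hk (hT k hkT)
    rcases h2 with ⟨h3, -⟩ | ⟨h3, -⟩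
    · exact supp_of_nonpos _ j (hu i j) (fun k hk => h3 k (hT' k hk))
    · exact supp_of_nonneg _ j (hu i j) (fun k hk => h3 k (hT' k hk))) a b c d hq
  simp [ha, hb, hc] at h

theorem edge_card {F : Type*} [Field F] [CharZero F] [IsAlgClosed F] {s : ℕ}
    (u : Fin s → Fin 10 → ℤ)
    (hu : ∀ i j, ∑ k, u i k * veroneseA k j = 0)
    (hcrit : Crit (F := F) u) (j : Fin 3) (x y z w : Fin 10)
    (hE : ∀ i, veroneseA i j = 0 ↔ i = x ∨ i = y ∨ i = z ∨ i = w)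
    (hne : x ≠ y ∧ x ≠ z ∧ x ≠ w ∧ y ≠ z ∧ y ≠ w ∧ z ≠ w)
    (hL : ∀ v : Fin 10 → ℤ, (∀ j, ∑ k, v k * veroneseA k j = 0) →
      (∀ k, veroneseA k j ≠ 0 → v k = 0) → 3 * v x + 2 * v y + v z = 0 ∧
        v y + 2 * v z + 3 * v w = 0)
    (q1 : ∀ j, veroneseA y j + veroneseA y j = veroneseA x j + veroneseA z j)
    (q2 : ∀ j, veroneseA z j + veroneseA z j = veroneseA w j + veroneseA y j)
    (q3 : ∀ j, veroneseA x j + veroneseA w j = veroneseA y j + veroneseA z j) :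
    3 ≤ (edgeSet u j).card := by
  obtain ⟨hxy, hxz, hxw, hyz, hyw, hzw⟩ := hne
  have hEx := (hE x).2 (by simp)
  have hEy := (hE y).2 (by simp)
  have hEz := (hE z).2 (by simp)
  have hEw := (hE w).2 (by simp)
  obtain ⟨i, hiS, hi⟩ := exists_cover u hu hcrit j {y} (by simp [hEy]) y y x z q1
    (by simp) (by simp) (by simp [hxy])
  obtain ⟨k, hkS, hk⟩ := exists_cover u hu hcrit j {z} (by simp [hEz]) z z w y q2
    (by simp) (by simp) (by simp [hzw.symm])
  obtain ⟨l, hlS, hl⟩ := exists_cover u hu hcrit j {x, w} (by simp [hEx, hEw]) x w y z q3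
    (by simp) (by simp) (by simp [hxy.symm, hyw])
  have hS : ∀ i ∈ edgeSet u j, ∀ k, veroneseA k j ≠ 0 → u i k = 0 := by
    intro i hi
    simp only [edgeSet, Finset.mem_filter, Finset.mem_univ, true_and] at hi
    exact hi.2
  have four : ∀ i ∈ edgeSet u j, ∀ t, u i t ≠ 0 → t = x ∨ t = y ∨ t = z ∨ t = w := by
    intro i hi t ht
    rw [← hE]
    by_contra h0
    exact ht (hS i hi t h0)
  have hi' : (u i x ≤ 0 ∧ u i z ≤ 0 ∧ u i w ≤ 0 ∧ (u i x < 0 ∨ u i z < 0 ∨ u i w < 0)) ∨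
      (0 ≤ u i x ∧ 0 ≤ u i z ∧ 0 ≤ u i w ∧ (0 < u i x ∨ 0 < u i z ∨ 0 < u i w)) := by
    rcases hi with ⟨h, t, ht, ht'⟩ | ⟨h, t, ht, ht'⟩
    · left
      refine ⟨h x (by simp [hxy]), h z (by simp [hyz.symm]), h w (by simp [hyw.symm]), ?_⟩
      rcases four i hiS t ht'.ne with e | e | e | e <;> rw [e] at ht ht'
      · exact Or.inl ht'
      · exact absurd (Finset.mem_singleton_self _) ht
      · exact Or.inr (Or.inl ht')
      · exact Or.inr (Or.inr ht')
    · right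
      refine ⟨h x (by simp [hxy]), h z (by simp [hyz.symm]), h w (by simp [hyw.symm]), ?_⟩
      rcases four i hiS t ht'.ne' with e | e | e | e <;> rw [e] at ht ht'
      · exact Or.inl ht'
      · exact absurd (Finset.mem_singleton_self _) ht
      · exact Or.inr (Or.inl ht')
      · exact Or.inr (Or.inr ht')
  have hk' : (u k x ≤ 0 ∧ u k y ≤ 0 ∧ u k w ≤ 0 ∧ (u k x < 0 ∨ u k y < 0 ∨ u k w < 0)) ∨
      (0 ≤ u k x ∧ 0 ≤ u k y ∧ 0 ≤ u k w ∧ (0 < u k x ∨ 0 < u k y ∨ 0 < u k w)) := by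
    rcases hk with ⟨h, t, ht, ht'⟩ | ⟨h, t, ht, ht'⟩
    · left
      refine ⟨h x (by simp [hxz]), h y (by simp [hyz]), h w (by simp [hzw.symm]), ?_⟩
      rcases four k hkS t ht'.ne with e | e | e | e <;> rw [e] at ht ht'
      · exact Or.inl ht'
      · exact Or.inr (Or.inl ht')
      · exact absurd (Finset.mem_singleton_self _) ht
      · exact Or.inr (Or.inr ht')
    · right
      refine ⟨h x (by simp [hxz]), h y (by simp [hyz]), h w (by simp [hzw.symm]), ?_⟩
      rcases four k hkS t ht'.ne' with e | e | e | e <;> rw [e] at ht ht'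
      · exact Or.inl ht'
      · exact Or.inr (Or.inl ht')
      · exact absurd (Finset.mem_singleton_self _) ht
      · exact Or.inr (Or.inr ht')
  have hl' : (u l y ≤ 0 ∧ u l z ≤ 0) ∨ (0 ≤ u l y ∧ 0 ≤ u l z) := by
    rcases hl with ⟨h, -⟩ | ⟨h, -⟩
    · left
      exact ⟨h y (by simp [hxy.symm, hyw]), h z (by simp [hxz.symm, hzw])⟩
    · right
      exact ⟨h y (by simp [hxy.symm, hyw]), h z (by simp [hxz.symm, hzw])⟩
  clear hi hk hl
  have ei := hL (u i) (hu i) (hS i hiS)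
  have ek := hL (u k) (hu k) (hS k hkS)
  have hik : i ≠ k := by
    rintro rfl
    omega
  by_contra hcard
  have htwo : ∀ t ∈ edgeSet u j, t = i ∨ t = k := by
    intro t ht
    by_contra hc
    push Not at hc
    exact hcard (Finset.two_lt_card.2 ⟨i, hiS, k, hkS, t, ht, hik, hc.1.symm, hc.2.symm⟩)
  have hmem : ∀ t, (∀ k, veroneseA k j ≠ 0 → u t k = 0) → u t = 0 ∨ t = i ∨ t = k := by
    intro t ht
    by_cases h0 : u t = 0
    · exact Or.inl h0
    · right
      apply htwo
      simp only [edgeSet, Finset.mem_filter, Finset.mem_univ, true_and]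
      exact ⟨h0, ht⟩
  rcases htwo l hlS with rfl | rfl
  · have hz0 : u l z = 0 := by omega
    have hb : 2 ≤ (u k z).natAbs := by omega
    obtain ⟨ζ, h1, hζ⟩ := exists_root (F := F) _ hb
    have := hcrit (zpt j z ζ) (by
      intro t
      apply VV_zpt j z hEz ζ (u t) (hu t j)
      intro ht
      rcases hmem t ht with h | rfl | rfl
      · simp [h]
      · simp [hz0]
      · exact hζ) y y x z q1
    simp [zpt, hyz, hEy, hEx, hxz] at this
    exact h1 this.symm
  · have hy0 : u l y = 0 := by omega
    have hb : 2 ≤ (u i y).natAbs := by omega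
    obtain ⟨ζ, h1, hζ⟩ := exists_root (F := F) _ hb
    have := hcrit (zpt j y ζ) (by
      intro t
      apply VV_zpt j y hEy ζ (u t) (hu t j)
      intro ht
      rcases hmem t ht with h | rfl | rfl
      · simp [h]
      · exact hζ
      · simp [hy0]) z z w y q2
    simp [zpt, hyz.symm, hEz, hEw, hyw.symm] at this
    exact h1 this.symm

/-- The indices of binomials not supported on any facet. -/
def restSet {s : ℕ} (u : Fin s → Fin 10 → ℤ) : Finset (Fin s) :=
  Finset.univ.filter fun i => ∀ j, ¬ ∀ k, veroneseA k j ≠ 0 → u i k = 0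

theorem VV_of_zpow {F : Type*} [Field F] (x : Fin 10 → F) (hx : ∀ i, x i ≠ 0) (u : Fin 10 → ℤ)
    (h : ∏ i, x i ^ (u i) = 1) : VV x u := by
  unfold VV
  have e : ∏ i, x i ^ (u i) = (∏ i, x i ^ (u i).toNat) * (∏ i, x i ^ (-u i).toNat)⁻¹ := by
    rw [← Finset.prod_inv_distrib, ← Finset.prod_mul_distrib]
    apply Finset.prod_congr rfl
    intro i _
    rw [← zpow_natCast, ← zpow_natCast, ← zpow_neg, ← zpow_add₀ (hx i)]
    congr 1
    omega
  rw [e] at h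
  exact (mul_inv_eq_one₀ (Finset.prod_ne_zero_iff.2 fun i _ => pow_ne_zero _ (hx i))).1 h

theorem sums (v : Fin 10 → ℤ) (h : ∀ j, ∑ k, v k * veroneseA k j = 0) :
    3 * v 0 + 2 * v 3 + v 4 + 2 * v 7 + v 8 + v 9 = 0 ∧
    3 * v 1 + v 3 + 2 * v 4 + 2 * v 5 + v 6 + v 9 = 0 ∧
    3 * v 2 + v 5 + 2 * v 6 + v 7 + 2 * v 8 + v 9 = 0 := by
  have h0 := h 0
  have h1 := h 1
  have h2 := h 2
  simp [Fin.sum_univ_succ, veroneseA, Fin.succ] at h0 h1 h2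
  refine ⟨?_, ?_, ?_⟩ <;> linarith

theorem rest_card {F : Type*} [Field F] [CharZero F] [IsAlgClosed F] {s : ℕ}
    (u : Fin s → Fin 10 → ℤ)
    (hu : ∀ i j, ∑ k, u i k * veroneseA k j = 0)
    (hcrit : Crit (F := F) u) : 2 ≤ (restSet u).card := by
  by_contra hcard
  have huniq : ∀ i ∈ restSet u, ∀ k ∈ restSet u, i = k := Finset.card_le_one.1 (by omega)
  have : NeZero ((3 : ℕ) : F) := ⟨by norm_num⟩
  obtain ⟨ζ, hζ⟩ := HasEnoughRootsOfUnity.exists_primitiveRoot F 3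
  have hζ0 : ζ ≠ 0 := hζ.ne_zero (by norm_num)
  have hst : ∃ p t : ℤ, ¬ (3 ∣ p ∧ 3 ∣ t) ∧
      ∀ i ∈ restSet u, 3 ∣ p * u i 9 + t * (u i 3 + 2 * u i 4) := by
    by_cases hne : ∃ i, i ∈ restSet u
    · obtain ⟨i, hi⟩ := hne
      by_cases h0 : 3 ∣ u i 9 ∧ 3 ∣ (u i 3 + 2 * u i 4)
      · refine ⟨1, 0, by omega, ?_⟩
        intro k hk
        rw [huniq k hk i hi]
        omega
      · refine ⟨u i 3 + 2 * u i 4, -u i 9, by omega, ?_⟩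
        intro k hk
        rw [huniq k hk i hi]
        exact ⟨0, by ring⟩
    · exact ⟨1, 0, by omega, fun i hi => absurd ⟨i, hi⟩ hne⟩
  obtain ⟨p, t, hpt, hrest⟩ := hst
  have hone : ∀ n : ℤ, ζ ^ n = 1 ↔ 3 ∣ n := by
    intro n
    exact_mod_cast hζ.zpow_eq_one_iff_dvd n
  have hV := hcrit (fun i => ζ ^ ((![0, 0, 0, t, 2 * t, 0, 0, 0, 0, p] : Fin 10 → ℤ) i)) (by
    intro i
    apply VV_of_zpow _ (fun i => zpow_ne_zero _ hζ0)
    simp_rw [← zpow_mul]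
    have : ∏ k, ζ ^ ((![0, 0, 0, t, 2 * t, 0, 0, 0, 0, p] : Fin 10 → ℤ) k * u i k)
        = ζ ^ (p * u i 9 + t * (u i 3 + 2 * u i 4)) := by
      simp [Fin.prod_univ_succ, Fin.succ]
      rw [← zpow_add₀ hζ0, ← zpow_add₀ hζ0]
      congr 1
      ring
    rw [this, hone]
    by_cases hi : i ∈ restSet u
    · exact hrest i hi
    · have hj : ∃ j, ∀ k, veroneseA k j ≠ 0 → u i k = 0 := by
        by_contra hc
        apply hi
        simp only [restSet, Finset.mem_filter, Finset.mem_univ, true_and]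
        exact fun j hj => hc ⟨j, hj⟩
      obtain ⟨j, hj⟩ := hj
      obtain ⟨e0, e1, e2⟩ := sums (u i) (hu i)
      have z9 : u i 9 = 0 := hj 9 (by fin_cases j <;> decide)
      have z34 : 3 ∣ u i 3 + 2 * u i 4 := by
        fin_cases j
        · rw [hj 3 (by decide), hj 4 (by decide)]; omega
        · rw [hj 3 (by decide), hj 4 (by decide)]; omega
        · have := hj 5 (by decide)
          have := hj 6 (by decide)
          have := hj 7 (by decide)
          have := hj 8 (by decide)
          omega
      rw [z9, mul_zero, zero_add]
      exact Dvd.dvd.mul_left z34 t)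
  have c1 := hV 9 0 3 7 (by decide)
  have c2 := hV 9 1 4 5 (by decide)
  simp at c1 c2
  have d1 : ζ ^ (p - t) = 1 := by
    rw [zpow_sub₀ hζ0, c1, div_self (zpow_ne_zero _ hζ0)]
  have d2 : ζ ^ (p - 2 * t) = 1 := by
    rw [zpow_sub₀ hζ0, c2, div_self (zpow_ne_zero _ hζ0)]
  rw [hone] at d1 d2
  omega

theorem lower {F : Type*} [Field F] [CharZero F] [IsAlgClosed F] {s : ℕ}
    (u : Fin s → Fin 10 → ℤ)
    (hu : ∀ i j, ∑ k, u i k * veroneseA k j = 0)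
    (hcrit : Crit (F := F) u) : 11 ≤ s := by
  have c2 : 3 ≤ (edgeSet u 2).card := by
    refine edge_card u hu hcrit 2 0 3 4 1 (by decide) (by decide) ?_ (by decide) (by decide)
      (by decide)
    intro v hv h0
    obtain ⟨e0, e1, e2⟩ := sums v hv
    have := h0 5 (by decide)
    have := h0 6 (by decide)
    have := h0 7 (by decide)
    have := h0 8 (by decide)
    have := h0 9 (by decide)
    omega
  have c1 : 3 ≤ (edgeSet u 1).card := by
    refine edge_card u hu hcrit 1 0 7 8 2 (by decide) (by decide) ?_ (by decide) (by decide)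
      (by decide)
    intro v hv h0
    obtain ⟨e0, e1, e2⟩ := sums v hv
    have := h0 5 (by decide)
    have := h0 6 (by decide)
    have := h0 3 (by decide)
    have := h0 4 (by decide)
    have := h0 9 (by decide)
    omega
  have c0 : 3 ≤ (edgeSet u 0).card := by
    refine edge_card u hu hcrit 0 1 5 6 2 (by decide) (by decide) ?_ (by decide) (by decide)
      (by decide)
    intro v hv h0
    obtain ⟨e0, e1, e2⟩ := sums v hv
    have := h0 7 (by decide)
    have := h0 8 (by decide)
    have := h0 3 (by decide)
    have := h0 4 (by decide)
    have := h0 9 (by decide)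
    omega
  have cr := rest_card u hu hcrit
  have hdis : ∀ j k, j ≠ k → Disjoint (edgeSet u j) (edgeSet u k) := by
    intro j k hjk
    rw [Finset.disjoint_left]
    intro i hi hi'
    simp only [edgeSet, Finset.mem_filter, Finset.mem_univ, true_and] at hi hi'
    apply hi.1
    obtain ⟨e0, e1, e2⟩ := sums (u i) (hu i)
    have hz : ∀ t, veroneseA t j ≠ 0 ∨ veroneseA t k ≠ 0 → u i t = 0 := by
      rintro t (h | h)
      · exact hi.2 t h
      · exact hi'.2 t h
    have hA : ∀ t : Fin 10, 3 ≤ t → ∀ j k : Fin 3, j ≠ k →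
        veroneseA t j ≠ 0 ∨ veroneseA t k ≠ 0 := by decide
    have z3 := hz 3 (hA 3 (by decide) j k hjk)
    have z4 := hz 4 (hA 4 (by decide) j k hjk)
    have z5 := hz 5 (hA 5 (by decide) j k hjk)
    have z6 := hz 6 (hA 6 (by decide) j k hjk)
    have z7 := hz 7 (hA 7 (by decide) j k hjk)
    have z8 := hz 8 (hA 8 (by decide) j k hjk)
    have z9 := hz 9 (hA 9 (by decide) j k hjk)
    funext t
    fin_cases t <;> simp <;> omega
  have hdr : ∀ j, Disjoint (edgeSet u j) (restSet u) := by
    intro j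
    rw [Finset.disjoint_left]
    intro i hi hi'
    simp only [edgeSet, restSet, Finset.mem_filter, Finset.mem_univ, true_and] at hi hi'
    exact hi' j hi.2
  have hcard : (((edgeSet u 0 ∪ edgeSet u 1) ∪ edgeSet u 2) ∪ restSet u).card
      = (edgeSet u 0).card + (edgeSet u 1).card + (edgeSet u 2).card + (restSet u).card := by
    rw [Finset.card_union_of_disjoint, Finset.card_union_of_disjoint,
      Finset.card_union_of_disjoint]
    · exact hdis 0 1 (by decide)
    · exact Finset.disjoint_union_left.2 ⟨hdis 0 2 (by decide), hdis 1 2 (by decide)⟩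
    · exact Finset.disjoint_union_left.2
        ⟨Finset.disjoint_union_left.2 ⟨hdr 0, hdr 1⟩, hdr 2⟩
  have hle := Finset.card_le_univ (((edgeSet u 0 ∪ edgeSet u 1) ∪ edgeSet u 2) ∪ restSet u)
  rw [Fintype.card_fin] at hle
  omega

theorem quad_mem (K : Type*) [Field K] (a b c d : Fin 10)
    (h : ∀ j, veroneseA a j + veroneseA b j = veroneseA c j + veroneseA d j) :
    (X a * X b - X c * X d : MvPolynomial (Fin 10) K) ∈ toricIdeal K veroneseA := by
  have := mem_toric K veroneseA (Finsupp.single a 1 + Finsupp.single b 1)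
    (Finsupp.single c 1 + Finsupp.single d 1) (by
      intro j
      simp only [Finsupp.add_apply, Nat.cast_add, add_mul, Finset.sum_add_distrib]
      simpa [Finsupp.single_apply] using h j)
  have e : ∀ a b : Fin 10, (monomial (Finsupp.single a 1 + Finsupp.single b 1) 1 :
      MvPolynomial (Fin 10) K) = X a * X b := by
    intro a b
    rw [X, X, monomial_mul, one_mul]
  rwa [e, e] at this

theorem crit_of_radical {K F : Type*} [Field K] [Field F] [Algebra K F] {s : ℕ}
    (f : Fin s → MvPolynomial (Fin 10) K) (u : Fin s → Fin 10 → ℤ)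
    (hdvd : ∀ i, (monomial (pp (u i)) (1 : K) - monomial (np (u i)) 1) ∣ f i)
    (hrad : Ideal.radical (Ideal.span (Set.range f)) = Ideal.radical (toricIdeal K veroneseA)) :
    Crit (F := F) u := by
  intro x hx a b c d hq
  have h1 : Ideal.span (Set.range f) ≤
      RingHom.ker (aeval x : MvPolynomial (Fin 10) K →ₐ[K] F) := by
    apply Ideal.span_le.2
    rintro _ ⟨i, rfl⟩
    obtain ⟨g, hg⟩ := hdvd i
    rw [SetLike.mem_coe, RingHom.mem_ker, hg, map_mul, (aeval_B x (u i)).2 (hx i), zero_mul]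
  have h2 : (X a * X b - X c * X d : MvPolynomial (Fin 10) K) ∈
      Ideal.radical (Ideal.span (Set.range f)) := by
    rw [hrad]
    exact Ideal.le_radical (quad_mem K a b c d hq)
  have h3 := ((RingHom.ker_isPrime
    (aeval x : MvPolynomial (Fin 10) K →ₐ[K] F)).radical_le_iff.2 h1) h2
  rw [RingHom.mem_ker] at h3
  simpa [sub_eq_zero] using h3

/-- Eleven binomials. -/
noncomputable def gens (K : Type*) [Field K] : Fin 11 → MvPolynomial (Fin 10) K :=
  ![X 3 * X 3 - X 0 * X 4, X 4 * X 4 - X 3 * X 1, X 3 * X 4 - X 0 * X 1,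
    X 7 * X 7 - X 0 * X 8, X 8 * X 8 - X 7 * X 2, X 7 * X 8 - X 0 * X 2,
    X 5 * X 5 - X 1 * X 6, X 6 * X 6 - X 5 * X 2, X 5 * X 6 - X 1 * X 2,
    X 9 * X 9 - X 7 * X 5, X 9 * X 9 * X 9 - X 3 * X 5 * X 8]

theorem param_exists {F : Type*} [Field F] (x : Fin 10 → F)
    (a1 : x 3 * x 3 = x 0 * x 4) (a2 : x 4 * x 4 = x 3 * x 1) (a3 : x 3 * x 4 = x 0 * x 1)
    (b1 : x 7 * x 7 = x 0 * x 8) (b2 : x 8 * x 8 = x 7 * x 2) (b3 : x 7 * x 8 = x 0 * x 2)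
    (c1 : x 5 * x 5 = x 1 * x 6) (c2 : x 6 * x 6 = x 5 * x 2) (c3 : x 5 * x 6 = x 1 * x 2)
    (d1 : x 9 * x 9 = x 7 * x 5) (d2 : x 9 * x 9 * x 9 = x 3 * x 5 * x 8) :
    ∃ (s : F) (t : Fin 3 → F), ∀ i, x i = s * ∏ j, t j ^ (veroneseA i j).toNat := by
  by_cases h0 : x 0 = 0
  · have h3 : x 3 = 0 := by simpa [h0] using a1
    have h4 : x 4 = 0 := by simpa [h3] using a2
    have h7 : x 7 = 0 := by simpa [h0] using b1
    have h8 : x 8 = 0 := by simpa [h7] using b2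
    have h9 : x 9 = 0 := by simpa [h7] using d1
    by_cases h1 : x 1 = 0
    · have h5 : x 5 = 0 := by simpa [h1] using c1
      have h6 : x 6 = 0 := by simpa [h5] using c2
      refine ⟨x 2, ![0, 0, 1], ?_⟩
      intro i
      fin_cases i <;> simp [Fin.prod_univ_three, veroneseA, h0, h1, h3, h4, h5, h6, h7, h8, h9]
    · have h6 : x 6 = x 1 * (x 5 / x 1) ^ 2 := by
        field_simp
        linear_combination -c1
      have h2 : x 2 = x 1 * (x 5 / x 1) ^ 3 := by
        field_simp
        linear_combination (-x 1) * c3 - x 5 * c1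
      have h5 : x 5 = x 1 * (x 5 / x 1) := by field_simp
      refine ⟨x 1, ![0, 1, x 5 / x 1], ?_⟩
      intro i
      fin_cases i <;> simp [Fin.prod_univ_three, veroneseA, h0, h3, h4, h7, h8, h9]
      · exact h2
      · exact h5
      · exact h6
  · obtain ⟨a, ha⟩ : ∃ a, x 3 = x 0 * a := ⟨x 3 / x 0, by field_simp⟩
    obtain ⟨b, hb⟩ : ∃ b, x 7 = x 0 * b := ⟨x 7 / x 0, by field_simp⟩
    have h4 : x 4 = x 0 * a ^ 2 := by
      apply mul_left_cancel₀ h0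
      rw [← a1, ha]; ring
    have h1 : x 1 = x 0 * a ^ 3 := by
      apply mul_left_cancel₀ h0
      rw [← a3, ha, h4]; ring
    have h8 : x 8 = x 0 * b ^ 2 := by
      apply mul_left_cancel₀ h0
      rw [← b1, hb]; ring
    have h2 : x 2 = x 0 * b ^ 3 := by
      apply mul_left_cancel₀ h0
      rw [← b3, hb, h8]; ring
    have main : x 5 = x 0 * (a ^ 2 * b) ∧ x 6 = x 0 * (a * b ^ 2) ∧ x 9 = x 0 * (a * b) := by
      by_cases ha0 : a = 0
      · have h1' : x 1 = 0 := by simp [h1, ha0]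
        have h5 : x 5 = 0 := by simpa [h1'] using c1
        have h6 : x 6 = 0 := by simpa [h5] using c2
        have h9 : x 9 = 0 := by simpa [h5] using d1
        simp [h5, h6, h9, ha0]
      · by_cases hb0 : b = 0
        · have h2' : x 2 = 0 := by simp [h2, hb0]
          have h6 : x 6 = 0 := by simpa [h2'] using c2
          have h5 : x 5 = 0 := by simpa [h6] using c1
          have h9 : x 9 = 0 := by simpa [h5] using d1
          simp [h5, h6, h9, hb0]
        · have h1' : x 1 ≠ 0 := by simp [h1, ha0, h0]
          have h2' : x 2 ≠ 0 := by simp [h2, hb0, h0]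
          have h5' : x 5 ≠ 0 := by
            intro h
            rw [h, zero_mul] at c3
            exact mul_ne_zero h1' h2' c3.symm
          have h7' : x 7 ≠ 0 := by simp [hb, hb0, h0]
          have h9 : x 9 = x 0 * (a * b) := by
            apply mul_left_cancel₀ (mul_ne_zero h7' h5')
            have e : x 7 * x 5 * x 9 = x 9 * x 9 * x 9 := by rw [d1]
            rw [e, d2, ha, h8, hb]; ring
          have h5 : x 5 = x 0 * (a ^ 2 * b) := by
            apply mul_left_cancel₀ h7'
            rw [← d1, h9, hb]; ring
          have h6 : x 6 = x 0 * (a * b ^ 2) := by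
            apply mul_left_cancel₀ h1'
            rw [← c1, h5, h1]; ring
          exact ⟨h5, h6, h9⟩
    obtain ⟨h5, h6, h9⟩ := main
    refine ⟨x 0, ![1, a, b], ?_⟩
    intro i
    fin_cases i <;> simp [Fin.prod_univ_three, veroneseA]
    · exact h1
    · exact h2
    · exact ha
    · exact h4
    · exact h5
    · exact h6
    · exact hb
    · exact h8
    · exact h9

theorem isBinomial_sub {K : Type*} [Field K] (a b : Fin 10 →₀ ℕ) (p q : MvPolynomial (Fin 10) K)
    (hp : p = monomial a 1) (hq : q = monomial b 1) : IsBinomial (p - q) :=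
  ⟨a, b, 1, -1, by rw [hp, hq, map_neg, sub_eq_add_neg]⟩

theorem isBinomial_quad {K : Type*} [Field K] (a b c d : Fin 10) :
    IsBinomial (X a * X b - X c * X d : MvPolynomial (Fin 10) K) :=
  isBinomial_sub (Finsupp.single a 1 + Finsupp.single b 1)
    (Finsupp.single c 1 + Finsupp.single d 1) _ _ (by rw [X, X, monomial_mul, one_mul])
    (by rw [X, X, monomial_mul, one_mul])

theorem isBinomial_cub {K : Type*} [Field K] (a b c d e f : Fin 10) :
    IsBinomial (X a * X b * X c - X d * X e * X f : MvPolynomial (Fin 10) K) :=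
  isBinomial_sub (Finsupp.single a 1 + Finsupp.single b 1 + Finsupp.single c 1)
    (Finsupp.single d 1 + Finsupp.single e 1 + Finsupp.single f 1) _ _
    (by rw [X, X, X, monomial_mul, monomial_mul, one_mul, one_mul])
    (by rw [X, X, X, monomial_mul, monomial_mul, one_mul, one_mul])

theorem gens_mem (K : Type*) [Field K] : ∀ i, gens K i ∈ toricIdeal K veroneseA ∧
    IsBinomial (gens K i) := by
  have hc : (X 9 * X 9 * X 9 - X 3 * X 5 * X 8 : MvPolynomial (Fin 10) K) ∈
      toricIdeal K veroneseA := by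
    have e : (X 9 * X 9 * X 9 - X 3 * X 5 * X 8 : MvPolynomial (Fin 10) K)
        = X 9 * (X 9 * X 9 - X 3 * X 6) + X 3 * (X 6 * X 9 - X 5 * X 8) := by ring
    rw [e]
    exact Ideal.add_mem _ (Ideal.mul_mem_left _ _ (quad_mem K 9 9 3 6 (by decide)))
      (Ideal.mul_mem_left _ _ (quad_mem K 6 9 5 8 (by decide)))
  intro i
  fin_cases i
  iterate 10
    · exact ⟨quad_mem K _ _ _ _ (by decide), isBinomial_quad _ _ _ _⟩
  exact ⟨hc, isBinomial_cub _ _ _ _ _ _⟩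

theorem gens_radical (K : Type*) [Field K] :
    Ideal.radical (Ideal.span (Set.range (gens K))) = Ideal.radical (toricIdeal K veroneseA) := by
  apply le_antisymm
  · apply Ideal.radical_mono
    apply Ideal.span_le.2
    rintro _ ⟨i, rfl⟩
    exact (gens_mem K i).1
  · apply (Ideal.radical_isRadical _).radical_le_iff.2
    rw [Ideal.radical_eq_sInf]
    apply le_sInf
    rintro P ⟨hJ, hP⟩
    intro g hg
    let R := MvPolynomial (Fin 10) K ⧸ P
    let F := FractionRing R
    let φ : MvPolynomial (Fin 10) K →ₐ[K] F :=
      (IsScalarTower.toAlgHom K R F).comp (Ideal.Quotient.mkₐ K P)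
    have hker : ∀ p, φ p = 0 ↔ p ∈ P := by
      intro p
      rw [← Ideal.Quotient.eq_zero_iff_mem]
      exact map_eq_zero_iff (algebraMap R F) (IsFractionRing.injective R F)
    have hφ : φ = aeval (fun i => φ (X i)) := by
      ext i
      simp
    have hrel : ∀ i, φ (gens K i) = 0 := fun i =>
      (hker _).2 (hJ (Ideal.subset_span ⟨i, rfl⟩))
    have hr : ∀ i p q, gens K i = p - q → φ p = φ q := by
      intro i p q h
      have := hrel i
      rwa [h, map_sub, sub_eq_zero] at this
    obtain ⟨s, t, hst⟩ := param_exists (fun i => φ (X i))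
      (by simpa only [map_mul] using hr 0 _ _ rfl) (by simpa only [map_mul] using hr 1 _ _ rfl)
      (by simpa only [map_mul] using hr 2 _ _ rfl) (by simpa only [map_mul] using hr 3 _ _ rfl)
      (by simpa only [map_mul] using hr 4 _ _ rfl) (by simpa only [map_mul] using hr 5 _ _ rfl)
      (by simpa only [map_mul] using hr 6 _ _ rfl) (by simpa only [map_mul] using hr 7 _ _ rfl)
      (by simpa only [map_mul] using hr 8 _ _ rfl) (by simpa only [map_mul] using hr 9 _ _ rfl)
      (by simpa only [map_mul] using hr 10 _ _ rfl)
    have := param_kills (fun i => φ (X i)) s t hst g hg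
    rw [← hφ, hker] at this
    exact this

/-- in characteristic zero the binomial arithmetical rank of the toric ideal of
the `(3,3)`-Veronese configuration equals `11`. -/
theorem statement12 {K : Type*} [Field K] [CharZero K] :
    bar (toricIdeal K veroneseA) = 11 := by
  unfold bar
  apply le_antisymm
  · apply Nat.sInf_le
    exact ⟨gens K, gens_mem K, gens_radical K⟩
  · refine le_csInf ?_ ?_
    · exact ⟨11, gens K, gens_mem K, gens_radical K⟩
    rintro s ⟨f, hf, hrad⟩
    choose u hu hdvd using fun i => binom_form (f i) (hf i).1 (hf i).2
    exact lower (F := AlgebraicClosure K) u hu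
      (crit_of_radical f u hdvd hrad)

end LatticePaper
end

section
/- Let K be a field of characteristic 3 and let I_A ⊂ K[x₁,…,x₁₀] be the toric ideal of the (3,3)-Veronese configuration A = {(a₁,a₂,a₃) ∈ ℕ³ : a₁+a₂+a₃ = 3}. Then the binomial arithmetical rank of I_A equals 7, which equals the height of I_A; in particular I_A is a set-theoretic complete intersection on binomials. -/
open MvPolynomial

namespace LatticePaper

/-- Every maximal ideal of `K[x₁,…,xₙ]` has height `n`. -/
lemma height_maximal_mvPoly {K : Type*} [Field K] (n : ℕ) :
    ∀ M : Ideal (MvPolynomial (Fin n) K), M.IsMaximal → M.height = n := by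
  induction n with
  | zero =>
    intro M hM
    have h1 := Ideal.height_le_ringKrullDim_of_ne_top hM.ne_top
    rw [MvPolynomial.ringKrullDim_of_isNoetherianRing] at h1
    simp only [ringKrullDim_eq_zero_of_field, Nat.card_eq_fintype_card, Fintype.card_fin] at h1
    have h2 : M.height ≤ 0 := by exact_mod_cast h1
    simpa using h2
  | succ n ih =>
    intro M hM
    let e := (MvPolynomial.finSuccEquiv K n).toRingEquiv
    let P : Ideal (Polynomial (MvPolynomial (Fin n) K)) := M.comap e.symm
    have hP : P.IsMaximal := Ideal.comap_isMaximal_of_surjective _ e.symm.surjective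
    have hp : (P.comap (Polynomial.C)).IsMaximal :=
      Polynomial.isMaximal_comap_C_of_isJacobsonRing P
    have hl : P.LiesOver (P.comap (Polynomial.C)) := ⟨rfl⟩
    have h1 := Polynomial.height_eq_height_add_one (P.comap (Polynomial.C)) P
    have h2 : P.height = M.height := RingEquiv.height_comap e.symm M
    rw [← h2, h1, ih _ hp]
    push_cast
    rfl

/-- Binomials whose two monomials have the same degree lie in the toric ideal. -/
lemma binom_mem_toricIdeal (K : Type*) [Field K] {m n : ℕ} (A : Fin m → Fin n → ℤ)
    (a b : Fin m →₀ ℕ) (h : ∀ j, ∑ i, (a i : ℤ) * A i j = ∑ i, (b i : ℤ) * A i j) :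
    monomial a (1 : K) - monomial b 1 ∈ toricIdeal K A := by
  set u : Fin m → ℤ := fun i => (a i : ℤ) - b i with hu
  have ha : a = a ⊓ b + pp u := by
    ext i
    simp only [pp, hu, Finsupp.add_apply, Finsupp.inf_apply, Finsupp.equivFunOnFinite_symm_apply_apply]
    omega
  have hb : b = a ⊓ b + np u := by
    ext i
    simp only [np, hu, Finsupp.add_apply, Finsupp.inf_apply, Finsupp.equivFunOnFinite_symm_apply_apply]
    omega
  have hmem : monomial (pp u) (1 : K) - monomial (np u) 1 ∈ toricIdeal K A := by
    refine Ideal.subset_span ⟨u, ?_, rfl⟩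
    ext j
    simp [hu, sub_mul, Finset.sum_sub_distrib, h j]
  have : monomial a (1 : K) - monomial b 1
      = monomial (a ⊓ b) 1 * (monomial (pp u) (1 : K) - monomial (np u) 1) := by
    rw [mul_sub, monomial_mul, monomial_mul, ← ha, ← hb, one_mul]
  rw [this]
  exact Ideal.mul_mem_left _ _ hmem

/-- The exponent vector `(a₁,a₂,a₃,0,…,0)` attached to the `i`-th point of the configuration. -/
noncomputable def wv (i : Fin 10) : Fin 10 →₀ ℕ :=
  Finsupp.single 0 (veroneseA i 0).toNat + Finsupp.single 1 (veroneseA i 1).toNat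
    + Finsupp.single 2 (veroneseA i 2).toNat

/-- The binomials `xᵢ³ - x₁^{a₁} x₂^{a₂} x₃^{a₃}`. -/
noncomputable def Gv (K : Type*) [Field K] (i : Fin 10) : MvPolynomial (Fin 10) K :=
  monomial (Finsupp.single i 3) 1 - monomial (wv i) 1

lemma Gv_mem (K : Type*) [Field K] (i : Fin 10) : Gv K i ∈ toricIdeal K veroneseA := by
  apply binom_mem_toricIdeal
  intro j
  simp only [wv, Finsupp.add_apply, Nat.cast_add, add_mul, Finset.sum_add_distrib,
    Finsupp.single_apply, Nat.cast_ite, ite_mul, Nat.cast_zero, zero_mul, Finset.sum_ite_eq,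
    Finset.mem_univ, if_true]
  revert i j
  decide

lemma Gv_zero (K : Type*) [Field K] (i : Fin 10) (hi : (i : ℕ) < 3) : Gv K i = 0 := by
  have : i = 0 ∨ i = 1 ∨ i = 2 := by omega
  rcases this with rfl | rfl | rfl <;> simp [Gv, wv, veroneseA]

/-- The family of the seven binomials. -/
noncomputable def fam (K : Type*) [Field K] (k : Fin 7) : MvPolynomial (Fin 10) K :=
  Gv K (Fin.natAdd 3 k)

lemma Gv_mem_fam (K : Type*) [Field K] (i : Fin 10) :
    Gv K i ∈ Ideal.span (Set.range (fam K)) := by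
  by_cases hi : (i : ℕ) < 3
  · rw [Gv_zero K i hi]; exact zero_mem _
  · refine Ideal.subset_span ⟨⟨i - 3, by omega⟩, ?_⟩
    unfold fam
    congr 1
    ext
    simp
    omega

lemma cube_mem (K : Type*) [Field K] (a : Fin 10 →₀ ℕ) :
    (monomial a (1 : K)) ^ 3 - monomial (∑ i, a i • wv i) 1
      ∈ Ideal.span (Set.range (fam K)) := by
  rw [← Ideal.Quotient.eq]
  set q := Ideal.Quotient.mk (Ideal.span (Set.range (fam K))) with hq
  have h1 : ∀ i, q (monomial (Finsupp.single i 3) 1) = q (monomial (wv i) 1) := fun i =>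
    Ideal.Quotient.eq.2 (Gv_mem_fam K i)
  have h2 : (monomial a (1 : K)) ^ 3 = ∏ i, (monomial (Finsupp.single i 3) (1 : K)) ^ (a i) := by
    simp only [monomial_pow, one_pow]
    rw [← monomial_sum_one]
    have he : 3 • a = ∑ i, a i • Finsupp.single i 3 := by
      ext j
      simp [Finsupp.finsetSum_apply, Finsupp.single_apply, mul_comm]
    rw [he]
  have h3 : monomial (∑ i, a i • wv i) (1 : K) = ∏ i, (monomial (wv i) (1 : K)) ^ (a i) := by
    rw [monomial_sum_one]
    simp only [monomial_pow, one_pow]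
  rw [h2, h3, map_prod, map_prod]
  simp only [map_pow, h1]

lemma wsum_eq (u : Fin 10 → ℤ) (hu : ∑ i, u i • veroneseA i = 0) :
    ∑ i, pp u i • wv i = ∑ i, np u i • wv i := by
  have key : ∀ j, ∑ i, (u i).toNat * (veroneseA i j).toNat
      = ∑ i, (-u i).toNat * (veroneseA i j).toNat := by
    intro j
    have h := congrFun hu j
    simp only [Finset.sum_apply, Pi.smul_apply, smul_eq_mul, Pi.zero_apply] at h
    have hn : ∀ i, ((veroneseA i j).toNat : ℤ) = veroneseA i j := by
      intro i
      apply Int.toNat_of_nonneg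
      fin_cases i <;> fin_cases j <;> simp [veroneseA]
    zify
    rw [← sub_eq_zero, ← Finset.sum_sub_distrib, ← h]
    refine Finset.sum_congr rfl fun i _ => ?_
    rw [hn, ← sub_mul]
    congr 1
    omega
  ext j
  simp only [wv, pp, np, Finsupp.finsetSum_apply, Finsupp.smul_apply, Finsupp.add_apply,
    Finsupp.equivFunOnFinite_symm_apply_apply, smul_eq_mul, mul_add, Finset.sum_add_distrib,
    Finsupp.single_apply, mul_ite, mul_zero]
  congr 1
  · congr 1
    · split_ifs <;> simp [key]
    · split_ifs <;> simp [key]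
  · split_ifs <;> simp [key]

lemma toric_le_radical (K : Type*) [Field K] [CharP K 3] :
    toricIdeal K veroneseA ≤ (Ideal.span (Set.range (fam K))).radical := by
  refine Ideal.span_le.2 ?_
  rintro f ⟨u, hu, rfl⟩
  refine ⟨3, ?_⟩
  have : Fact (Nat.Prime 3) := ⟨Nat.prime_three⟩
  rw [sub_pow_char]
  have h1 := cube_mem K (pp u)
  have h2 := cube_mem K (np u)
  rw [wsum_eq u hu] at h1
  have := Ideal.sub_mem _ h1 h2
  rwa [sub_sub_sub_cancel_right] at this

lemma toric_le_ker (K : Type*) [Field K] :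
    toricIdeal K veroneseA ≤ RingHom.ker (constantCoeff : MvPolynomial (Fin 10) K →+* K) := by
  refine Ideal.span_le.2 ?_
  rintro f ⟨u, hu, rfl⟩
  have hs : ∑ i, u i = 0 := by
    have h : ∀ j, ∑ i, u i * veroneseA i j = 0 := by
      intro j
      simpa using congrFun hu j
    have h0 := h 0
    have h1 := h 1
    have h2 := h 2
    simp [Fin.sum_univ_succ, veroneseA] at h0 h1 h2 ⊢
    omega
  have hz : pp u = 0 ↔ np u = 0 := by
    have e1 : pp u = 0 ↔ ∀ i, u i ≤ 0 := by
      simp [Finsupp.ext_iff, pp]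
    have e2 : np u = 0 ↔ ∀ i, 0 ≤ u i := by
      simp [Finsupp.ext_iff, np]
    rw [e1, e2]
    constructor
    · intro h i
      exact ((Finset.sum_eq_zero_iff_of_nonpos fun i _ => h i).1 hs i (Finset.mem_univ i)).ge
    · intro h i
      exact ((Finset.sum_eq_zero_iff_of_nonneg fun i _ => h i).1 hs i (Finset.mem_univ i)).le
  simp only [SetLike.mem_coe, RingHom.mem_ker, map_sub, constantCoeff_monomial]
  by_cases h : pp u = 0
  · rw [if_pos h, if_pos (hz.1 h), sub_self]
  · rw [if_neg h, if_neg (fun h' => h (hz.2 h')), sub_self]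

lemma ker_le_of_X_mem {K : Type*} [Field K] (q : Ideal (MvPolynomial (Fin 10) K))
    (h : ∀ i, X i ∈ q) :
    RingHom.ker (constantCoeff : MvPolynomial (Fin 10) K →+* K) ≤ q := by
  intro f hf
  rw [RingHom.mem_ker] at hf
  rw [f.as_sum]
  refine Ideal.sum_mem _ fun d hd => ?_
  have hd0 : d ≠ 0 := by
    rintro rfl
    exact (mem_support_iff.1 hd) hf
  obtain ⟨i, hi⟩ := Finsupp.ne_iff.1 hd0
  have : (X i : MvPolynomial (Fin 10) K) ∣ monomial d (coeff d f) := by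
    rw [X_dvd_monomial]
    exact Or.inr hi
  exact Ideal.mem_of_dvd _ this (h i)

lemma seven_le {K : Type*} [Field K] (s : ℕ) (f : Fin s → MvPolynomial (Fin 10) K)
    (hf : ∀ i, f i ∈ toricIdeal K veroneseA)
    (hr : (Ideal.span (Set.range f)).radical = (toricIdeal K veroneseA).radical) : 7 ≤ s := by
  classical
  set M := RingHom.ker (constantCoeff : MvPolynomial (Fin 10) K →+* K) with hM
  have hmax : M.IsMaximal := RingHom.ker_isMaximal_of_surjective _ fun c => ⟨C c, by simp⟩
  let T : Finset (MvPolynomial (Fin 10) K) := Finset.univ.image f ∪ {X 0, X 1, X 2}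
  have hmin : M ∈ (Ideal.span (T : Set (MvPolynomial (Fin 10) K))).minimalPrimes := by
    refine ⟨⟨hmax.isPrime, ?_⟩, ?_⟩
    · refine Ideal.span_le.2 ?_
      intro g hg
      simp only [T, Finset.coe_union, Finset.coe_image, Finset.coe_univ, Set.image_univ,
        Set.mem_union, Set.mem_range, Finset.coe_insert, Finset.coe_singleton,
        Set.mem_insert_iff, Set.mem_singleton_iff] at hg
      rcases hg with ⟨i, rfl⟩ | rfl | rfl | rfl
      · exact toric_le_ker K (hf i)
      all_goals simp [hM, RingHom.mem_ker]
    · rintro q ⟨hq, hTq⟩ -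
      have hTq' : (T : Set (MvPolynomial (Fin 10) K)) ⊆ q := Ideal.span_le.1 hTq
      have hI : toricIdeal K veroneseA ≤ q := by
        refine Ideal.le_radical.trans ?_
        rw [← hr]
        refine hq.radical_le_iff.2 (Ideal.span_le.2 ?_)
        rintro _ ⟨i, rfl⟩
        exact hTq' (by simp [T])
      have h0 : (X 0 : MvPolynomial (Fin 10) K) ∈ q := hTq' (by simp [T])
      have h1 : (X 1 : MvPolynomial (Fin 10) K) ∈ q := hTq' (by simp [T])
      have h2 : (X 2 : MvPolynomial (Fin 10) K) ∈ q := hTq' (by simp [T])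
      apply ker_le_of_X_mem
      intro i
      have hw : monomial (wv i) (1 : K) ∈ q := by
        have hd : wv i 0 ≠ 0 ∨ wv i 1 ≠ 0 ∨ wv i 2 ≠ 0 := by
          fin_cases i <;> simp [wv, veroneseA]
        rcases hd with h | h | h
        · exact Ideal.mem_of_dvd _ (X_dvd_monomial.2 (Or.inr h)) h0
        · exact Ideal.mem_of_dvd _ (X_dvd_monomial.2 (Or.inr h)) h1
        · exact Ideal.mem_of_dvd _ (X_dvd_monomial.2 (Or.inr h)) h2
      have hG := hI (Gv_mem K i)
      have hX : (X i : MvPolynomial (Fin 10) K) ^ 3 ∈ q := by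
        have := Ideal.add_mem _ hG hw
        rw [Gv, sub_add_cancel] at this
        rwa [X_pow_eq_monomial]
      exact hq.mem_of_pow_mem _ hX
  have hle := Ideal.height_le_card_of_mem_minimalPrimes_span_finset hmin
  rw [height_maximal_mvPoly 10 M hmax] at hle
  have hc : 10 ≤ T.card := by exact_mod_cast hle
  have h1 : T.card ≤ (Finset.univ.image f).card + ({X 0, X 1, X 2} : Finset (MvPolynomial (Fin 10) K)).card :=
    Finset.card_union_le _ _
  have h2 : (Finset.univ.image f).card ≤ s := by
    simpa using Finset.card_image_le (s := Finset.univ) (f := f)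
  have h3 : ({X 0, X 1, X 2} : Finset (MvPolynomial (Fin 10) K)).card ≤ 3 := Finset.card_le_three
  omega

end LatticePaper

namespace LatticePaper

/-- in characteristic `3` the binomial arithmetical rank of the toric ideal of
the `(3,3)`-Veronese configuration equals `7 = 10 - 3`, its height: `I_A` is a set-theoretic
complete intersection on binomials. -/
theorem statement13 {K : Type*} [Field K] [CharP K 3] :
    bar (toricIdeal K veroneseA) = 7 := by
  have h7 : (7 : ℕ) ∈ {s : ℕ | ∃ f : Fin s → MvPolynomial (Fin 10) K,
      (∀ i, f i ∈ toricIdeal K veroneseA ∧ IsBinomial (f i)) ∧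
      Ideal.radical (Ideal.span (Set.range f)) = Ideal.radical (toricIdeal K veroneseA)} := by
    refine ⟨fam K, fun i => ⟨Gv_mem K _, ?_⟩, le_antisymm ?_ ?_⟩
    · refine ⟨Finsupp.single (Fin.natAdd 3 i) 3, wv (Fin.natAdd 3 i), 1, -1, ?_⟩
      rw [fam, Gv, sub_eq_add_neg, ← map_neg]
    · refine Ideal.radical_mono (Ideal.span_le.2 ?_)
      rintro _ ⟨i, rfl⟩
      exact Gv_mem K _
    · exact Ideal.radical_le_radical_iff.2 (toric_le_radical K)
  refine le_antisymm (Nat.sInf_le h7) (le_csInf ⟨7, h7⟩ ?_)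
  rintro s ⟨f, hf, hr⟩
  exact seven_le s f (fun i => (hf i).1) hr

end LatticePaper
end
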